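/- Let b be a rational function in the closed unit ball of H^∞ with ‖b‖_∞ = 1, non-extreme (equivalently, not a finite Blaschke product), with Pythagorean mate a, and let ζ₁,…,ζ_l ∈ 𝕋 be the zeros of a on 𝕋 with multiplicities m₁,…,m_l. Let Λ = (λ_n)_{n∈ℕ} be a sequence in 𝔻. Then the following are equivalent: (i) Λ is multiplier interpolating for H(b); (ii) Λ is universal interpolating for H(b); (iii) Λ satisfies the Carleson condition and Σ_{n∈ℕ} (1−|λ_n|²)/|ζ_j−λ_n|^{2m_j} < ∞ for every 1 ≤ j ≤ l. -/

import Mathlib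

open Complex MeasureTheory Metric Set Finset Filter ProbabilityTheory Polynomial
open scoped ENNReal NNReal Topology

noncomputable section

/-- Membership in the Hardy space `H²` of the unit disk: `f` is holomorphic on `𝔻` and the
mean-square integrals over circles of radius `r < 1` are uniformly bounded. -/
def MemHardy2 (f : ℂ → ℂ) : Prop :=
  DifferentiableOn ℂ f (ball (0 : ℂ) 1) ∧
  ∃ C : ℝ, ∀ r : ℝ, 0 < r → r < 1 →
    (1 / (2 * Real.pi)) * ∫ t in (0 : ℝ)..(2 * Real.pi),
      ‖f ((r : ℂ) * Complex.exp ((t : ℂ) * Complex.I))‖ ^ 2 ≤ C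

/-- The squared `H²` norm of `f`, as the supremum of the circle means. -/
def h2NormSq (f : ℂ → ℂ) : ℝ :=
  sSup {y : ℝ | ∃ r : ℝ, 0 < r ∧ r < 1 ∧
    y = (1 / (2 * Real.pi)) * ∫ t in (0 : ℝ)..(2 * Real.pi),
      ‖f ((r : ℂ) * Complex.exp ((t : ℂ) * Complex.I))‖ ^ 2}

/-- Membership in the de Branges-Rovnyak space `H(b)`, where `b` is rational and non-extreme
with Pythagorean mate `a` whose zeros on the circle are `ζ j` with multiplicities `m j`:
`f = ∏ (z - ζ j)^(m j) · g + p` on `𝔻` with `g ∈ H²` and `p` a polynomial of degree `< ∑ m j`. -/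
def MemHb {l : ℕ} (ζ : Fin l → ℂ) (m : Fin l → ℕ) (f : ℂ → ℂ) : Prop :=
  ∃ (g : ℂ → ℂ) (p : Polynomial ℂ), MemHardy2 g ∧ p.degree < ((∑ j, m j : ℕ) : ℕ) ∧
    ∀ z ∈ ball (0 : ℂ) 1, f z = (∏ j, (z - ζ j) ^ m j) * g z + p.eval z

/-- The Carleson condition: the pseudohyperbolic products `∏_{k ≠ n} ρ(Λ n, Λ k)` are
uniformly bounded below (formulated over all finite subsets not containing `n`). -/
def CarlesonCond (Λ : ℕ → ℂ) : Prop :=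
  ∃ δ : ℝ, 0 < δ ∧ ∀ n : ℕ, ∀ F : Finset ℕ, n ∉ F →
    δ ≤ ∏ k ∈ F, ‖(Λ n - Λ k) / (1 - (starRingEnd ℂ) (Λ k) * Λ n)‖

/-- `Λ` is universal interpolating for `H(b)`: the restriction map
`f ↦ (f(Λ n)/‖k^b_{Λ n}‖)` is bounded from `H(b)` into `ℓ²` and onto `ℓ²`.  Here
`‖k^b_λ‖² = (1-|b(λ)|²)/(1-|λ|²)`, and the `H(b)` norm of `f = ∏(z-ζ_j)^{m_j} g + p` is
`(‖g‖² + ‖p‖²)^{1/2}`. -/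
def UnivInterp {l : ℕ} (ζ : Fin l → ℂ) (m : Fin l → ℕ) (b : ℂ → ℂ) (Λ : ℕ → ℂ) : Prop :=
  (∃ C : ℝ, ∀ (g : ℂ → ℂ) (p : Polynomial ℂ), MemHardy2 g → p.degree < ((∑ j, m j : ℕ) : ℕ) →
    ∀ F : Finset ℕ,
      ∑ n ∈ F, ‖(∏ j, (Λ n - ζ j) ^ m j) * g (Λ n) + p.eval (Λ n)‖ ^ 2 *
          ((1 - ‖Λ n‖ ^ 2) / (1 - ‖b (Λ n)‖ ^ 2)) ≤
        C * (h2NormSq g + h2NormSq fun z => p.eval z)) ∧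
  ∀ w : ℕ → ℂ, Summable (fun n => ‖w n‖ ^ 2) →
    ∃ f : ℂ → ℂ, MemHb ζ m f ∧
      ∀ n, f (Λ n) * (Real.sqrt ((1 - ‖Λ n‖ ^ 2) / (1 - ‖b (Λ n)‖ ^ 2)) : ℂ) = w n

/-- `Λ` is multiplier interpolating for `H(b)`: every bounded sequence can be interpolated
by a multiplier of `H(b)`. -/
def MultInterp {l : ℕ} (ζ : Fin l → ℂ) (m : Fin l → ℕ) (Λ : ℕ → ℂ) : Prop :=
  ∀ v : ℕ → ℂ, (∃ C : ℝ, ∀ n, ‖v n‖ ≤ C) →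
    ∃ φ : ℂ → ℂ, (∀ f : ℂ → ℂ, MemHb ζ m f → MemHb ζ m fun z => φ z * f z) ∧
      ∀ n, φ (Λ n) = v n

/-- The mean of `|f|²` over the circle of radius `r` centred at the origin. -/
def circleMean (f : ℂ → ℂ) (r : ℝ) : ℝ :=
  (1 / (2 * Real.pi)) * ∫ t in (0 : ℝ)..(2 * Real.pi),
    ‖f ((r : ℂ) * Complex.exp ((t : ℂ) * Complex.I))‖ ^ 2

lemma norm_mul_exp_mul_I {r : ℝ} (hr : 0 ≤ r) (t : ℝ) :
    ‖(r : ℂ) * Complex.exp ((t : ℂ) * Complex.I)‖ = r := by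
  rw [norm_mul, Complex.norm_exp_ofReal_mul_I, mul_one, Complex.norm_real, Real.norm_of_nonneg hr]

/-- Parseval's identity for power series on the unit disk. -/
lemma hasSum_circleMean {f : ℂ → ℂ} {c : ℕ → ℂ}
    (h : ∀ z : ℂ, ‖z‖ < 1 → HasSum (fun k => c k * z ^ k) (f z)) {r : ℝ} (hr : 0 ≤ r)
    (hr1 : r < 1) : HasSum (fun k => ‖c k‖ ^ 2 * r ^ (2 * k)) (circleMean f r) := by
  have hrn : ‖(r : ℂ)‖ < 1 := by rwa [Complex.norm_real, Real.norm_of_nonneg hr]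
  have hs : Summable (fun k => ‖c k‖ * r ^ k) := by
    have := (h r hrn).summable.norm
    simpa [abs_of_nonneg hr] using this
  rw [hasSum_iff_tendsto_nat_of_nonneg (fun k => by positivity)]
  set P : ℕ → ℂ[X] := fun K => ∑ k ∈ Finset.range K, Polynomial.monomial k (c k * (r : ℂ) ^ k)
    with hP
  have hcoeff : ∀ K k, (P K).coeff k = if k < K then c k * (r : ℂ) ^ k else 0 := by
    intro K k
    simp [hP, Polynomial.finsetSum_coeff, Polynomial.coeff_monomial]
  have hsum : ∀ K, ∑ k ∈ Finset.range K, ‖c k‖ ^ 2 * r ^ (2 * k) =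
      Real.circleAverage (fun θ ↦ ‖(P K).eval θ‖ ^ 2) 0 1 := by
    intro K
    rw [← Polynomial.sum_sq_norm_coeff_eq_circleAverage]
    have hsub : (P K).support ⊆ Finset.range K := by
      intro k hk
      rw [Polynomial.mem_support_iff, hcoeff] at hk
      simp only [Finset.mem_range]
      by_contra hcon
      simp [hcon] at hk
    rw [Finset.sum_subset hsub (fun k _ hk => by
      rw [Polynomial.notMem_support_iff] at hk; simp [hk])]
    refine Finset.sum_congr rfl fun k hk => ?_
    rw [hcoeff, if_pos (Finset.mem_range.1 hk), norm_mul, norm_pow, Complex.norm_real,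
      Real.norm_of_nonneg hr, mul_pow, ← pow_mul, mul_comm k 2]
  simp_rw [hsum]
  have heval : ∀ K (t : ℝ), (P K).eval (circleMap 0 1 t) =
      ∑ k ∈ Finset.range K, c k * ((r : ℂ) * Complex.exp ((t : ℂ) * Complex.I)) ^ k := by
    intro K t
    simp [hP, Polynomial.eval_finsetSum, circleMap, mul_pow, mul_assoc]
  simp only [Real.circleAverage, circleMean, smul_eq_mul, one_div]
  refine Tendsto.const_mul _ ?_
  refine intervalIntegral.tendsto_integral_filter_of_dominated_convergence
    (fun _ => (∑' k, ‖c k‖ * r ^ k) ^ 2) ?_ ?_ ?_ ?_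
  · refine Eventually.of_forall fun K => Continuous.aestronglyMeasurable ?_
    have : Continuous fun t : ℝ => (P K).eval (circleMap 0 1 t) :=
      (P K).continuous.comp (continuous_circleMap 0 1)
    fun_prop
  · refine Eventually.of_forall fun K => Eventually.of_forall fun t _ => ?_
    rw [Real.norm_of_nonneg (by positivity), heval]
    refine pow_le_pow_left₀ (norm_nonneg _) ?_ 2
    refine (norm_sum_le _ _).trans ?_
    have : ∀ k, ‖c k * ((r : ℂ) * Complex.exp ((t : ℂ) * Complex.I)) ^ k‖ = ‖c k‖ * r ^ k := by
      intro k
      rw [norm_mul, norm_pow, norm_mul_exp_mul_I hr]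
    simp_rw [this]
    exact hs.sum_le_tsum _ (fun k _ => by positivity)
  · exact intervalIntegrable_const
  · refine Eventually.of_forall fun t _ => ?_
    simp_rw [heval]
    exact ((h _ (by rwa [norm_mul_exp_mul_I hr])).tendsto_sum_nat.norm).pow 2

/-- A function holomorphic on the unit disk is the sum of a power series there. -/
lemma exists_hasSum_of_differentiableOn {f : ℂ → ℂ} (hf : DifferentiableOn ℂ f (ball (0 : ℂ) 1)) :
    ∃ c : ℕ → ℂ, ∀ z : ℂ, ‖z‖ < 1 → HasSum (fun k => c k * z ^ k) (f z) := by
  refine ⟨fun n => (Nat.factorial n : ℂ)⁻¹ * iteratedDeriv n f 0, fun z hz => ?_⟩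
  have h := Complex.hasSum_taylorSeries_on_ball hf (mem_ball_zero_iff.2 hz)
  have he : (fun n : ℕ => (Nat.factorial n : ℂ)⁻¹ • (z - 0) ^ n • iteratedDeriv n f 0) =
      fun n => (Nat.factorial n : ℂ)⁻¹ * iteratedDeriv n f 0 * z ^ n := by
    funext n
    simp only [sub_zero, smul_eq_mul]
    ring
  rwa [he] at h

/-- The Hilbert space of square-summable coefficient sequences. -/
abbrev SqSeq : Type := lp (fun _ : ℕ => ℂ) 2

lemma summable_sq_norm (c : SqSeq) : Summable fun k => ‖c k‖ ^ 2 := by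
  have := (lp.memℓp c).summable (by norm_num)
  simpa using this

lemma norm_sq_eq_tsum (c : SqSeq) : ‖c‖ ^ 2 = ∑' k, ‖c k‖ ^ 2 := by
  have := lp.norm_rpow_eq_tsum (p := 2) (by norm_num) c
  simpa using this

lemma exists_sqSeq {c : ℕ → ℂ} (hc : Summable fun k => ‖c k‖ ^ 2) :
    ∃ d : SqSeq, ∀ k, d k = c k :=
  ⟨⟨c, memℓp_gen (by simpa using hc)⟩, fun _ => rfl⟩

lemma memlp_conj_pow {z : ℂ} (hz : ‖z‖ < 1) :
    Memℓp (fun k : ℕ => (starRingEnd ℂ) z ^ k) 2 := by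
  refine memℓp_gen ?_
  have : Summable fun k : ℕ => (‖z‖ ^ 2) ^ k :=
    summable_geometric_of_lt_one (by positivity) (by nlinarith [norm_nonneg z])
  refine this.congr fun k => ?_
  simp [← pow_mul, mul_comm]

/-- The Szegő kernel at `z`, as a coefficient sequence. -/
def szego (z : ℂ) : SqSeq :=
  if h : ‖z‖ < 1 then ⟨fun k => (starRingEnd ℂ) z ^ k, memlp_conj_pow h⟩ else 0

lemma szego_apply {z : ℂ} (hz : ‖z‖ < 1) (k : ℕ) : szego z k = (starRingEnd ℂ) z ^ k := by
  rw [szego, dif_pos hz]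

/-- Evaluation at `z` of the power series with given square-summable coefficients. -/
def ev (z : ℂ) : SqSeq →L[ℂ] ℂ := innerSL ℂ (szego z)

lemma hasSum_ev {z : ℂ} (hz : ‖z‖ < 1) (c : SqSeq) : HasSum (fun k => c k * z ^ k) (ev z c) := by
  have := lp.hasSum_inner (𝕜 := ℂ) (szego z) c
  simpa [szego_apply hz, ev] using this

lemma ev_szego {z : ℂ} (hz : ‖z‖ < 1) : ev z (szego z) = ((1 - ‖z‖ ^ 2)⁻¹ : ℝ) := by
  have h1 := hasSum_ev hz (szego z)
  have h2 : HasSum (fun k : ℕ => (‖z‖ ^ 2) ^ k) (1 - ‖z‖ ^ 2)⁻¹ :=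
    hasSum_geometric_of_lt_one (by positivity) (by nlinarith [norm_nonneg z])
  have h3 := (Complex.hasSum_ofReal).2 h2
  refine h1.unique ?_
  convert h3 using 2 with k
  rw [szego_apply hz, ← mul_pow, Complex.conj_mul']
  push_cast
  rfl

lemma norm_szego_sq {z : ℂ} (hz : ‖z‖ < 1) : ‖szego z‖ ^ 2 = (1 - ‖z‖ ^ 2)⁻¹ := by
  have h := ev_szego hz
  rw [ev, innerSL_apply_apply, inner_self_eq_norm_sq_to_K] at h
  apply Complex.ofReal_injective
  rw [← h]
  push_cast
  rfl

lemma norm_ev_sq_mul_le {z : ℂ} (hz : ‖z‖ < 1) (c : SqSeq) :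
    ‖ev z c‖ ^ 2 * (1 - ‖z‖ ^ 2) ≤ ‖c‖ ^ 2 := by
  have hpos : 0 < 1 - ‖z‖ ^ 2 := by nlinarith [norm_nonneg z]
  have h : ‖ev z c‖ ≤ ‖szego z‖ * ‖c‖ := norm_inner_le_norm (𝕜 := ℂ) (szego z) c
  have h2 : ‖ev z c‖ ^ 2 ≤ ‖szego z‖ ^ 2 * ‖c‖ ^ 2 := by
    rw [← mul_pow]; exact pow_le_pow_left₀ (norm_nonneg _) h 2
  rw [norm_szego_sq hz] at h2
  calc ‖ev z c‖ ^ 2 * (1 - ‖z‖ ^ 2) ≤ (1 - ‖z‖ ^ 2)⁻¹ * ‖c‖ ^ 2 * (1 - ‖z‖ ^ 2) := by gcongr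
    _ = ‖c‖ ^ 2 := by field_simp

lemma differentiableOn_ev (c : SqSeq) : DifferentiableOn ℂ (fun z => ev z c) (ball (0 : ℂ) 1) := by
  intro z hz
  rw [mem_ball_zero_iff] at hz
  obtain ⟨ρ, hzρ, hρ⟩ := exists_between hz
  have hρ0 : 0 ≤ ρ := (norm_nonneg z).trans hzρ.le
  have hs : Summable fun k => ‖c k‖ * ρ ^ k := by
    have := (hasSum_ev (z := (ρ : ℂ)) (by simpa [abs_of_nonneg hρ0] using hρ) c).summable.norm
    simpa [abs_of_nonneg hρ0] using this
  have hd : DifferentiableOn ℂ (fun w => ∑' k, c k * w ^ k) (ball (0 : ℂ) ρ) := by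
    refine Complex.differentiableOn_tsum_of_summable_norm hs (fun k => by fun_prop) isOpen_ball ?_
    intro k w hw
    rw [mem_ball_zero_iff] at hw
    rw [norm_mul, norm_pow]
    gcongr
  have hz' : ball (0 : ℂ) ρ ∈ 𝓝 z := isOpen_ball.mem_nhds (mem_ball_zero_iff.2 hzρ)
  refine ((hd.differentiableAt hz').congr_of_eventuallyEq ?_).differentiableWithinAt
  filter_upwards [hz'] with w hw
  exact (hasSum_ev ((mem_ball_zero_iff.1 hw).trans hρ) c).tsum_eq.symm

lemma circleMean_ev_le (c : SqSeq) {r : ℝ} (hr : 0 ≤ r) (hr1 : r < 1) :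
    circleMean (fun z => ev z c) r ≤ ‖c‖ ^ 2 := by
  rw [norm_sq_eq_tsum]
  refine hasSum_le (fun k => ?_) (hasSum_circleMean (fun z hz => hasSum_ev hz c) hr hr1)
    (summable_sq_norm c).hasSum
  exact mul_le_of_le_one_right (by positivity) (pow_le_one₀ hr hr1.le)

lemma circleMean_congr {f g : ℂ → ℂ} (h : ∀ z : ℂ, ‖z‖ < 1 → f z = g z) {r : ℝ} (hr : 0 ≤ r)
    (hr1 : r < 1) : circleMean f r = circleMean g r := by
  unfold circleMean
  congr 1
  refine intervalIntegral.integral_congr fun t _ => ?_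
  rw [h _ (by rwa [norm_mul_exp_mul_I hr])]

lemma sum_sq_norm_le_of_circleMean_le {f : ℂ → ℂ} {c : ℕ → ℂ}
    (hc : ∀ z : ℂ, ‖z‖ < 1 → HasSum (fun k => c k * z ^ k) (f z)) {C : ℝ → ℝ} {C₀ : ℝ}
    (hC : Tendsto C (𝓝[<] 1) (𝓝 C₀)) (h : ∀ᶠ r in 𝓝[<] (1 : ℝ), circleMean f r ≤ C r)
    (F : Finset ℕ) : ∑ k ∈ F, ‖c k‖ ^ 2 ≤ C₀ := by
  have h1 : Tendsto (fun r : ℝ => ∑ k ∈ F, ‖c k‖ ^ 2 * r ^ (2 * k)) (𝓝[<] 1)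
      (𝓝 (∑ k ∈ F, ‖c k‖ ^ 2 * 1 ^ (2 * k))) := by
    refine Tendsto.mono_left (Continuous.tendsto ?_ 1) nhdsWithin_le_nhds
    fun_prop
  simp only [one_pow, mul_one] at h1
  refine le_of_tendsto_of_tendsto h1 hC ?_
  filter_upwards [h, Ioo_mem_nhdsLT (zero_lt_one' ℝ)] with r hr hr0
  exact (sum_le_hasSum F (fun k _ => by have := hr0.1; positivity)
    (hasSum_circleMean hc hr0.1.le hr0.2)).trans hr

/-- A holomorphic function whose circle means are asymptotically bounded by `C` is given by a
square-summable sequence of squared norm at most `C`. -/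
lemma exists_ev_of_circleMean_le {f : ℂ → ℂ} (hf : DifferentiableOn ℂ f (ball (0 : ℂ) 1))
    {C : ℝ → ℝ} {C₀ : ℝ} (hC : Tendsto C (𝓝[<] 1) (𝓝 C₀))
    (h : ∀ᶠ r in 𝓝[<] (1 : ℝ), circleMean f r ≤ C r) :
    ∃ c : SqSeq, ‖c‖ ^ 2 ≤ C₀ ∧ ∀ z : ℂ, ‖z‖ < 1 → f z = ev z c := by
  obtain ⟨c, hc⟩ := exists_hasSum_of_differentiableOn hf
  have hfin := sum_sq_norm_le_of_circleMean_le hc hC h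
  have hs : Summable fun k => ‖c k‖ ^ 2 := summable_of_sum_le (fun k => by positivity) hfin
  obtain ⟨d, hd⟩ := exists_sqSeq hs
  refine ⟨d, ?_, fun z hz => ?_⟩
  · rw [norm_sq_eq_tsum]
    simp_rw [hd]
    exact hs.tsum_le_of_sum_le hfin
  · refine (hc z hz).unique ?_
    simpa [hd] using hasSum_ev hz d

lemma memHardy2_iff {f : ℂ → ℂ} :
    MemHardy2 f ↔ ∃ c : SqSeq, ∀ z : ℂ, ‖z‖ < 1 → f z = ev z c := by
  constructor
  · rintro ⟨hf, C, hC⟩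
    obtain ⟨c, -, hc⟩ := exists_ev_of_circleMean_le hf (tendsto_const_nhds (x := C)) (by
      filter_upwards [Ioo_mem_nhdsLT (zero_lt_one' ℝ)] with r hr using hC r hr.1 hr.2)
    exact ⟨c, hc⟩
  · rintro ⟨c, hc⟩
    refine ⟨(differentiableOn_ev c).congr fun z hz => hc z (mem_ball_zero_iff.1 hz), ‖c‖ ^ 2,
      fun r hr hr1 => ?_⟩
    change circleMean f r ≤ _
    rw [circleMean_congr hc hr.le hr1]
    exact circleMean_ev_le c hr.le hr1

lemma memHardy2_ev (c : SqSeq) : MemHardy2 fun z => ev z c := memHardy2_iff.2 ⟨c, fun _ _ => rfl⟩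

lemma h2NormSq_eq {f : ℂ → ℂ} {c : SqSeq} (h : ∀ z : ℂ, ‖z‖ < 1 → f z = ev z c) :
    h2NormSq f = ‖c‖ ^ 2 := by
  have hm : ∀ r : ℝ, 0 < r → r < 1 → circleMean f r = circleMean (fun z => ev z c) r :=
    fun r hr hr1 => circleMean_congr h hr.le hr1
  have hub : ∀ y ∈ {y : ℝ | ∃ r : ℝ, 0 < r ∧ r < 1 ∧ y = circleMean f r}, y ≤ ‖c‖ ^ 2 := by
    rintro y ⟨r, hr, hr1, rfl⟩
    rw [hm r hr hr1]
    exact circleMean_ev_le c hr.le hr1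
  change sSup {y : ℝ | ∃ r : ℝ, 0 < r ∧ r < 1 ∧ y = circleMean f r} = _
  refine le_antisymm (csSup_le ⟨_, 1 / 2, by norm_num, by norm_num, rfl⟩ hub) ?_
  rw [norm_sq_eq_tsum]
  refine (summable_sq_norm c).tsum_le_of_sum_le
    (sum_sq_norm_le_of_circleMean_le (f := f) (fun z hz => h z hz ▸ hasSum_ev hz c)
      tendsto_const_nhds ?_)
  filter_upwards [Ioo_mem_nhdsLT (zero_lt_one' ℝ)] with r hr
  exact le_csSup ⟨_, hub⟩ ⟨r, hr.1, hr.2, rfl⟩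
lemma circleMean_nonneg (f : ℂ → ℂ) (r : ℝ) : 0 ≤ circleMean f r := by
  unfold circleMean
  have : 0 ≤ ∫ t in (0 : ℝ)..(2 * Real.pi),
      ‖f ((r : ℂ) * Complex.exp ((t : ℂ) * Complex.I))‖ ^ 2 :=
    intervalIntegral.integral_nonneg Real.two_pi_pos.le fun t _ => by positivity
  positivity

lemma sum_circleMean_le {ι κ : Type*} (s : Finset ι) (t : Finset κ) {f : ι → ℂ → ℂ}
    {g : κ → ℂ → ℂ} {w : κ → ℝ} (hf : ∀ i ∈ s, ContinuousOn (f i) (ball (0 : ℂ) 1))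
    (hg : ∀ j ∈ t, ContinuousOn (g j) (ball (0 : ℂ) 1)) {r : ℝ} (hr : 0 ≤ r) (hr1 : r < 1)
    (h : ∀ z : ℂ, ‖z‖ = r → ∑ i ∈ s, ‖f i z‖ ^ 2 ≤ ∑ j ∈ t, w j * ‖g j z‖ ^ 2) :
    ∑ i ∈ s, circleMean (f i) r ≤ ∑ j ∈ t, w j * circleMean (g j) r := by
  have hcont : ∀ F : ℂ → ℂ, ContinuousOn F (ball (0 : ℂ) 1) →
      Continuous fun u : ℝ => ‖F ((r : ℂ) * Complex.exp ((u : ℂ) * Complex.I))‖ ^ 2 := by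
    intro F hF
    refine (Continuous.norm ?_).pow 2
    refine hF.comp_continuous (by fun_prop) fun u => ?_
    rw [mem_ball_zero_iff, norm_mul_exp_mul_I hr]
    exact hr1
  have key : ∫ u in (0 : ℝ)..(2 * Real.pi),
        ∑ i ∈ s, ‖f i ((r : ℂ) * Complex.exp ((u : ℂ) * Complex.I))‖ ^ 2 ≤
      ∫ u in (0 : ℝ)..(2 * Real.pi),
        ∑ j ∈ t, w j * ‖g j ((r : ℂ) * Complex.exp ((u : ℂ) * Complex.I))‖ ^ 2 := by
    refine intervalIntegral.integral_mono_on Real.two_pi_pos.le ?_ ?_ fun u _ =>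
      h _ (norm_mul_exp_mul_I hr u)
    · exact (continuous_finsetSum _ fun i hi => hcont _ (hf i hi)).intervalIntegrable _ _
    · exact (continuous_finsetSum _ fun j hj =>
        (hcont _ (hg j hj)).const_mul _).intervalIntegrable _ _
  rw [intervalIntegral.integral_finsetSum fun i hi => (hcont _ (hf i hi)).intervalIntegrable _ _,
    intervalIntegral.integral_finsetSum fun j hj =>
      ((hcont _ (hg j hj)).const_mul _).intervalIntegrable _ _] at key
  simp only [intervalIntegral.integral_const_mul] at key
  have h2 : (0 : ℝ) ≤ 1 / (2 * Real.pi) := by positivity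
  have := mul_le_mul_of_nonneg_left key h2
  rw [Finset.mul_sum, Finset.mul_sum] at this
  refine this.trans_eq (Finset.sum_congr rfl fun j _ => ?_)
  unfold circleMean
  ring

lemma tendsto_circleMean_ev (c : SqSeq) :
    Tendsto (circleMean fun z => ev z c) (𝓝[<] 1) (𝓝 (‖c‖ ^ 2)) := by
  rw [norm_sq_eq_tsum]
  have h : Tendsto (fun r : ℝ => ∑' k, ‖c k‖ ^ 2 * r ^ (2 * k)) (𝓝[<] 1)
      (𝓝 (∑' k, ‖c k‖ ^ 2)) := by
    refine tendsto_tsum_of_dominated_convergence (summable_sq_norm c) (fun k => ?_) ?_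
    · have : Tendsto (fun r : ℝ => ‖c k‖ ^ 2 * r ^ (2 * k)) (𝓝[<] 1)
          (𝓝 (‖c k‖ ^ 2 * 1 ^ (2 * k))) :=
        (Continuous.tendsto (by fun_prop) 1).mono_left nhdsWithin_le_nhds
      simpa using this
    · filter_upwards [Ioo_mem_nhdsLT (zero_lt_one' ℝ)] with r hr k
      have h0 := hr.1
      rw [Real.norm_of_nonneg (by positivity)]
      exact mul_le_of_le_one_right (by positivity) (pow_le_one₀ hr.1.le hr.2.le)
  refine h.congr' ?_
  filter_upwards [Ioo_mem_nhdsLT (zero_lt_one' ℝ)] with r hr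
  exact (hasSum_circleMean (fun z hz => hasSum_ev hz c) hr.1.le hr.2).tsum_eq

/-- Domination principle: a pointwise inequality between sums of squares on the disk yields the
same inequality between `H²` norms. -/
lemma exists_ev_of_sum_sq_le {ι κ : Type*} (s : Finset ι) (t : Finset κ) {f : ι → ℂ → ℂ}
    {c : κ → SqSeq} {w : κ → ℝ} (hw : ∀ j ∈ t, 0 ≤ w j)
    (hf : ∀ i ∈ s, DifferentiableOn ℂ (f i) (ball (0 : ℂ) 1))
    (h : ∀ z : ℂ, ‖z‖ < 1 → ∑ i ∈ s, ‖f i z‖ ^ 2 ≤ ∑ j ∈ t, w j * ‖ev z (c j)‖ ^ 2) :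
    ∃ d : ι → SqSeq, (∀ i ∈ s, ∀ z : ℂ, ‖z‖ < 1 → f i z = ev z (d i)) ∧
      ∑ i ∈ s, ‖d i‖ ^ 2 ≤ ∑ j ∈ t, w j * ‖c j‖ ^ 2 := by
  have hm : ∀ᶠ r in 𝓝[<] (1 : ℝ),
      ∑ i ∈ s, circleMean (f i) r ≤ ∑ j ∈ t, w j * ‖c j‖ ^ 2 := by
    filter_upwards [Ioo_mem_nhdsLT (zero_lt_one' ℝ)] with r hr
    refine (sum_circleMean_le s t (fun i hi => (hf i hi).continuousOn)
      (fun j _ => (differentiableOn_ev (c j)).continuousOn) hr.1.le hr.2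
      fun z hz => h z (hz ▸ hr.2)).trans ?_
    exact Finset.sum_le_sum fun j hj =>
      mul_le_mul_of_nonneg_left (circleMean_ev_le _ hr.1.le hr.2) (hw j hj)
  have hex : ∀ i, ∃ d : SqSeq, i ∈ s → ∀ z : ℂ, ‖z‖ < 1 → f i z = ev z d := by
    intro i
    by_cases hi : i ∈ s
    · obtain ⟨d, -, hd⟩ := exists_ev_of_circleMean_le (hf i hi)
        (tendsto_const_nhds (x := ∑ j ∈ t, w j * ‖c j‖ ^ 2)) (by
          filter_upwards [hm] with r hr
          exact (Finset.single_le_sum (fun i _ => circleMean_nonneg (f i) r) hi).trans hr)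
      exact ⟨d, fun _ => hd⟩
    · exact ⟨0, fun h => absurd h hi⟩
  choose d hd using hex
  refine ⟨d, hd, ?_⟩
  have hlim : Tendsto (fun r => ∑ i ∈ s, circleMean (fun z => ev z (d i)) r) (𝓝[<] 1)
      (𝓝 (∑ i ∈ s, ‖d i‖ ^ 2)) := tendsto_finsetSum _ fun i _ => tendsto_circleMean_ev (d i)
  refine le_of_tendsto hlim ?_
  filter_upwards [hm, Ioo_mem_nhdsLT (zero_lt_one' ℝ)] with r hr hr0
  refine le_trans (le_of_eq (Finset.sum_congr rfl fun i hi => ?_)) hr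
  exact (circleMean_congr (hd i hi) hr0.1.le hr0.2).symm

/-- Multiplication by a bounded holomorphic function. -/
lemma exists_ev_mul {φ : ℂ → ℂ} (hφ : DifferentiableOn ℂ φ (ball (0 : ℂ) 1)) {M : ℝ}
    (hM : ∀ z : ℂ, ‖z‖ < 1 → ‖φ z‖ ≤ M) (c : SqSeq) :
    ∃ d : SqSeq, ∀ z : ℂ, ‖z‖ < 1 → ev z d = φ z * ev z c := by
  obtain ⟨d, hd, -⟩ := exists_ev_of_sum_sq_le (s := {()}) (t := {()})
    (f := fun _ z => φ z * ev z c) (c := fun _ => c) (w := fun _ => M ^ 2)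
    (fun _ _ => by positivity) (fun _ _ => hφ.mul (differentiableOn_ev c)) (fun z hz => by
      simp only [Finset.sum_singleton, norm_mul, mul_pow]
      have := hM z hz
      gcongr)
  exact ⟨d (), fun z hz => (hd () (by simp) z hz).symm⟩

lemma norm_eval_le (p : ℂ[X]) {z : ℂ} (hz : ‖z‖ ≤ 1) :
    ‖p.eval z‖ ≤ ∑ k ∈ p.support, ‖p.coeff k‖ := by
  rw [Polynomial.eval_eq_sum, Polynomial.sum]
  refine (norm_sum_le _ _).trans (Finset.sum_le_sum fun k _ => ?_)
  rw [norm_mul, norm_pow]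
  exact mul_le_of_le_one_right (norm_nonneg _) (pow_le_one₀ (norm_nonneg _) hz)

lemma exists_ev_eval_mul (p : ℂ[X]) (c : SqSeq) :
    ∃ d : SqSeq, ∀ z : ℂ, ‖z‖ < 1 → ev z d = p.eval z * ev z c :=
  exists_ev_mul p.differentiable.differentiableOn (fun _ hz => norm_eval_le p hz.le) c

lemma exists_ev_eval (p : ℂ[X]) :
    ∃ c : SqSeq, (∀ k, c k = p.coeff k) ∧ ∀ z : ℂ, ‖z‖ < 1 → p.eval z = ev z c := by
  obtain ⟨c, hc⟩ := exists_sqSeq (c := p.coeff) (summable_of_ne_finset_zero (s := p.support)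
    fun k hk => by simp [Polynomial.notMem_support_iff.1 hk])
  refine ⟨c, hc, fun z hz => ?_⟩
  refine HasSum.unique ?_ (hasSum_ev hz c)
  rw [Polynomial.eval_eq_sum, Polynomial.sum]
  simp_rw [hc]
  exact hasSum_sum_of_ne_finset_zero fun k hk => by simp [Polynomial.notMem_support_iff.1 hk]

/-- The elementary Blaschke factor with zero `w`. -/
def blaschke (w z : ℂ) : ℂ := (z - w) / (1 - (starRingEnd ℂ) w * z)

lemma one_sub_conj_mul_ne_zero {w z : ℂ} (hw : ‖w‖ < 1) (hz : ‖z‖ ≤ 1) :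
    1 - (starRingEnd ℂ) w * z ≠ 0 := by
  intro h
  have h1 : ‖(starRingEnd ℂ) w * z‖ = 1 := by rw [← sub_eq_zero.1 h, norm_one]
  rw [norm_mul, RCLike.norm_conj] at h1
  nlinarith [norm_nonneg w, norm_nonneg z]

lemma norm_one_sub_conj_mul_sq_sub (w z : ℂ) :
    ‖1 - (starRingEnd ℂ) w * z‖ ^ 2 - ‖z - w‖ ^ 2 = (1 - ‖w‖ ^ 2) * (1 - ‖z‖ ^ 2) := by
  simp only [← Complex.normSq_eq_norm_sq, Complex.normSq_apply, Complex.sub_re, Complex.sub_im,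
    Complex.mul_re, Complex.mul_im, Complex.conj_re, Complex.conj_im, Complex.one_re,
    Complex.one_im]
  ring

lemma one_sub_norm_blaschke_sq {w z : ℂ} (hw : ‖w‖ < 1) (hz : ‖z‖ ≤ 1) :
    1 - ‖blaschke w z‖ ^ 2 =
      (1 - ‖w‖ ^ 2) * (1 - ‖z‖ ^ 2) / ‖1 - (starRingEnd ℂ) w * z‖ ^ 2 := by
  have h := norm_pos_iff.2 (one_sub_conj_mul_ne_zero hw hz)
  rw [← norm_one_sub_conj_mul_sq_sub, blaschke, norm_div, div_pow, sub_div,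
    div_self (pow_ne_zero 2 h.ne')]

lemma norm_blaschke_le_one {w z : ℂ} (hw : ‖w‖ < 1) (hz : ‖z‖ ≤ 1) : ‖blaschke w z‖ ≤ 1 := by
  have h := one_sub_norm_blaschke_sq hw hz
  have h2 : 0 ≤ (1 - ‖w‖ ^ 2) * (1 - ‖z‖ ^ 2) / ‖1 - (starRingEnd ℂ) w * z‖ ^ 2 := by
    have h3 : 0 ≤ 1 - ‖w‖ ^ 2 := by nlinarith [norm_nonneg w]
    have h4 : 0 ≤ 1 - ‖z‖ ^ 2 := by nlinarith [norm_nonneg z]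
    positivity
  nlinarith [norm_nonneg (blaschke w z)]

lemma differentiableOn_blaschke {w : ℂ} (hw : ‖w‖ < 1) :
    DifferentiableOn ℂ (blaschke w) (ball (0 : ℂ) 1) := by
  unfold blaschke
  refine DifferentiableOn.div (by fun_prop) (by fun_prop) fun z hz => ?_
  exact one_sub_conj_mul_ne_zero hw (mem_ball_zero_iff.1 hz).le

/-- Division of a Hardy function by a Blaschke factor does not increase the norm. -/
lemma exists_ev_eq_blaschke_mul {w : ℂ} (hw : ‖w‖ < 1) {c : SqSeq} (hc : ev w c = 0) :
    ∃ d : SqSeq, ‖d‖ ^ 2 ≤ ‖c‖ ^ 2 ∧ ∀ z : ℂ, ‖z‖ < 1 → ev z c = blaschke w z * ev z d := by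
  set h : ℂ → ℂ := fun z => (1 - (starRingEnd ℂ) w * z) * dslope (fun z => ev z c) w z with hh
  have hd : DifferentiableOn ℂ h (ball (0 : ℂ) 1) := by
    refine DifferentiableOn.mul (by fun_prop) ?_
    rw [Complex.differentiableOn_dslope (isOpen_ball.mem_nhds (mem_ball_zero_iff.2 hw))]
    exact differentiableOn_ev c
  have hmul : ∀ z : ℂ, ‖z‖ < 1 → ev z c = blaschke w z * h z := by
    intro z hz
    have h1 := sub_smul_dslope (fun z => ev z c) w z
    have h2 := one_sub_conj_mul_ne_zero hw hz.le
    simp only [hc, sub_zero, smul_eq_mul] at h1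
    rw [← h1, hh, blaschke, div_mul_eq_mul_div, mul_left_comm, mul_div_cancel_left₀ _ h2]
  set K : ℝ := (1 - ‖w‖ ^ 2) / (1 - ‖w‖) ^ 2 with hK
  have hw0 : 0 < 1 - ‖w‖ := by linarith
  have hw2 : 0 ≤ 1 - ‖w‖ ^ 2 := by nlinarith [norm_nonneg w]
  have hlimK : Tendsto (fun r : ℝ => 1 - (1 - r ^ 2) * K) (𝓝[<] 1) (𝓝 1) := by
    have : Tendsto (fun r : ℝ => 1 - (1 - r ^ 2) * K) (𝓝[<] 1) (𝓝 (1 - (1 - 1 ^ 2) * K)) :=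
      (Continuous.tendsto (by fun_prop) 1).mono_left nhdsWithin_le_nhds
    simpa using this
  have hb : ∀ z : ℂ, ‖z‖ < 1 → 1 - (1 - ‖z‖ ^ 2) * K ≤ ‖blaschke w z‖ ^ 2 := by
    intro z hz
    have h1 := one_sub_norm_blaschke_sq hw hz.le
    have h2 : 1 - ‖w‖ ≤ ‖1 - (starRingEnd ℂ) w * z‖ := by
      have := norm_sub_norm_le (1 : ℂ) ((starRingEnd ℂ) w * z)
      rw [norm_one, norm_mul, RCLike.norm_conj] at this
      nlinarith [norm_nonneg w, norm_nonneg z]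
    have h3 : 0 ≤ 1 - ‖z‖ ^ 2 := by nlinarith [norm_nonneg z]
    have h4 : (1 - ‖w‖ ^ 2) * (1 - ‖z‖ ^ 2) / ‖1 - (starRingEnd ℂ) w * z‖ ^ 2 ≤
        (1 - ‖w‖ ^ 2) * (1 - ‖z‖ ^ 2) / (1 - ‖w‖) ^ 2 := by gcongr
    have h5 : (1 - ‖w‖ ^ 2) * (1 - ‖z‖ ^ 2) / (1 - ‖w‖) ^ 2 = (1 - ‖z‖ ^ 2) * K := by
      rw [hK]; ring
    linarith
  have hlim : Tendsto (fun r : ℝ => (1 - (1 - r ^ 2) * K)⁻¹ * ‖c‖ ^ 2) (𝓝[<] 1)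
      (𝓝 (1⁻¹ * ‖c‖ ^ 2)) := (hlimK.inv₀ one_ne_zero).mul_const _
  obtain ⟨d, hd1, hd2⟩ := exists_ev_of_circleMean_le hd hlim (by
    filter_upwards [hlimK.eventually (lt_mem_nhds zero_lt_one),
      Ioo_mem_nhdsLT (zero_lt_one' ℝ)] with r hr hr0
    have := sum_circleMean_le {()} {()} (f := fun _ => h) (g := fun _ z => ev z c)
      (w := fun _ => (1 - (1 - r ^ 2) * K)⁻¹) (fun _ _ => hd.continuousOn)
      (fun _ _ => (differentiableOn_ev c).continuousOn) hr0.1.le hr0.2 (fun z hz => by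
        simp only [Finset.sum_singleton]
        rw [hmul z (hz ▸ hr0.2), norm_mul (blaschke w z), mul_pow _ ‖h z‖, le_inv_mul_iff₀ hr]
        have := hb z (hz ▸ hr0.2)
        rw [hz] at this
        exact mul_le_mul_of_nonneg_right this (sq_nonneg _))
    simp only [Finset.sum_singleton] at this
    exact this.trans (mul_le_mul_of_nonneg_left (circleMean_ev_le c hr0.1.le hr0.2)
      (inv_nonneg.2 hr.le)))
  refine ⟨d, by simpa using hd1, fun z hz => ?_⟩
  rw [hmul z hz, hd2 z hz]

lemma blaschke_ne_zero {w z : ℂ} (hw : ‖w‖ < 1) (hz : ‖z‖ < 1) (h : z ≠ w) : blaschke w z ≠ 0 :=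
  div_ne_zero (sub_ne_zero.2 h) (one_sub_conj_mul_ne_zero hw hz.le)

lemma exists_ev_eq_prod_blaschke_mul {Λ : ℕ → ℂ} (hΛ : ∀ n, ‖Λ n‖ < 1)
    (hinj : Function.Injective Λ) {c : SqSeq} (F : Finset ℕ) (hc : ∀ k ∈ F, ev (Λ k) c = 0) :
    ∃ d : SqSeq, ‖d‖ ^ 2 ≤ ‖c‖ ^ 2 ∧
      ∀ z : ℂ, ‖z‖ < 1 → ev z c = (∏ k ∈ F, blaschke (Λ k) z) * ev z d := by
  induction F using Finset.induction_on with
  | empty => exact ⟨c, le_rfl, fun z _ => by simp⟩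
  | insert k F hk ih =>
    obtain ⟨d, hd, hd'⟩ := ih fun j hj => hc j (Finset.mem_insert_of_mem hj)
    have hz : ev (Λ k) d = 0 := by
      have h := hc k (Finset.mem_insert_self _ _)
      rw [hd' _ (hΛ k)] at h
      refine (mul_eq_zero.1 h).resolve_left (Finset.prod_ne_zero_iff.2 fun j hj => ?_)
      refine blaschke_ne_zero (hΛ j) (hΛ k) fun e => hk ?_
      rwa [hinj e]
    obtain ⟨e, he, he'⟩ := exists_ev_eq_blaschke_mul (hΛ k) hz
    refine ⟨e, he.trans hd, fun z hz => ?_⟩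
    rw [Finset.prod_insert hk, hd' z hz, he' z hz]
    ring

lemma norm_ev_sq_mul_le_prod {Λ : ℕ → ℂ} (hΛ : ∀ n, ‖Λ n‖ < 1)
    (hinj : Function.Injective Λ) {c : SqSeq} (F : Finset ℕ) (hc : ∀ k ∈ F, ev (Λ k) c = 0)
    {z : ℂ} (hz : ‖z‖ < 1) :
    ‖ev z c‖ ^ 2 * (1 - ‖z‖ ^ 2) ≤ ‖c‖ ^ 2 * (∏ k ∈ F, ‖blaschke (Λ k) z‖) ^ 2 := by
  obtain ⟨d, hd, hd'⟩ := exists_ev_eq_prod_blaschke_mul hΛ hinj F hc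
  rw [hd' z hz, norm_mul, norm_prod, mul_pow, mul_assoc, mul_comm (‖c‖ ^ 2)]
  exact mul_le_mul_of_nonneg_left ((norm_ev_sq_mul_le hz d).trans hd) (by positivity)

/-- Weak sequential compactness of balls, phrased with evaluations. -/
lemma exists_weak_limit {x : ℕ → SqSeq} {C : ℝ} (hx : ∀ i, ‖x i‖ ≤ C) :
    ∃ x₀ : SqSeq, ∃ U : Filter ℕ, U.NeBot ∧ U ≤ atTop ∧
      ∀ z, Tendsto (fun i => ev z (x i)) U (𝓝 (ev z x₀)) := by
  have hL : ∀ y : SqSeq, ∃ l : ℂ,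
      Tendsto (fun i => inner ℂ (x i) y) (hyperfilter ℕ : Filter ℕ) (𝓝 l) := by
    intro y
    obtain ⟨l, -, hl⟩ := (isCompact_closedBall (0 : ℂ) (C * ‖y‖)).ultrafilter_le_nhds
      ((hyperfilter ℕ).map fun i => inner ℂ (x i) y) (by
        rw [le_principal_iff]
        refine Filter.mem_map.2 (Eventually.of_forall fun i => ?_)
        change inner ℂ (x i) y ∈ closedBall 0 (C * ‖y‖)
        rw [mem_closedBall_zero_iff]
        exact (norm_inner_le_norm _ _).trans (by gcongr; exact hx i))
    exact ⟨l, hl⟩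
  choose L hL using hL
  let T : SqSeq →ₗ[ℂ] ℂ :=
    { toFun := L
      map_add' := fun y y' => tendsto_nhds_unique (hL _) (by
        simpa only [inner_add_right] using (hL y).add (hL y'))
      map_smul' := fun a y => tendsto_nhds_unique (hL _) (by
        simpa only [inner_smul_right, smul_eq_mul, RingHom.id_apply] using
          (hL y).const_mul a) }
  have hT : ∀ y, ‖T y‖ ≤ C * ‖y‖ := fun y =>
    le_of_tendsto (hL y).norm (Eventually.of_forall fun i =>
      (norm_inner_le_norm _ _).trans (by gcongr; exact hx i))
  set x₀ : SqSeq := (InnerProductSpace.toDual ℂ SqSeq).symm (T.mkContinuous C hT) with hx₀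
  refine ⟨x₀, hyperfilter ℕ, inferInstance, Nat.hyperfilter_le_atTop, fun z => ?_⟩
  have h1 : inner ℂ x₀ (szego z) = L (szego z) := by
    rw [hx₀, InnerProductSpace.toDual_symm_apply]
    rfl
  have h2 := hL (szego z)
  rw [← h1] at h2
  have h3 := (Complex.continuous_conj.tendsto _).comp h2
  simp only [Function.comp_def, inner_conj_symm] at h3
  exact h3
lemma ev_szego_eq {w z : ℂ} (hw : ‖w‖ < 1) (hz : ‖z‖ < 1) :
    ev z (szego w) = (1 - (starRingEnd ℂ) w * z)⁻¹ := by
  have h1 := hasSum_ev hz (szego w)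
  have h2 : HasSum (fun k : ℕ => ((starRingEnd ℂ) w * z) ^ k) (1 - (starRingEnd ℂ) w * z)⁻¹ := by
    refine hasSum_geometric_of_norm_lt_one ?_
    rw [norm_mul, RCLike.norm_conj]
    nlinarith [norm_nonneg w, norm_nonneg z]
  refine h1.unique ?_
  simpa only [szego_apply hw, mul_pow] using h2

lemma one_sub_norm_sq_pos {z : ℂ} (hz : ‖z‖ < 1) : 0 < 1 - ‖z‖ ^ 2 := by
  nlinarith [norm_nonneg z]

lemma sum_mul_exp_neg_le_one {ι : Type*} (F : Finset ι) (x r : ι → ℝ) (hx : ∀ i, 0 ≤ x i) :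
    ∑ n ∈ F, x n * Real.exp (-∑ k ∈ F with r n ≤ r k, x k) ≤
      1 - Real.exp (-∑ k ∈ F, x k) := by
  classical
  induction F using Finset.induction_on_min_value r with
  | empty => simp
  | insert a s ha hmin ih =>
    rw [Finset.sum_insert ha, Finset.sum_insert ha]
    have h1 : (∑ k ∈ insert a s with r a ≤ r k, x k) = x a + ∑ k ∈ s, x k := by
      rw [Finset.filter_true_of_mem, Finset.sum_insert ha]
      intro k hk
      rcases Finset.mem_insert.1 hk with rfl | hk
      · exact le_rfl
      · exact hmin k hk
    have h2 : ∑ n ∈ s, x n * Real.exp (-∑ k ∈ insert a s with r n ≤ r k, x k) ≤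
        ∑ n ∈ s, x n * Real.exp (-∑ k ∈ s with r n ≤ r k, x k) := by
      refine Finset.sum_le_sum fun n _ => mul_le_mul_of_nonneg_left (Real.exp_le_exp.2 ?_) (hx n)
      refine neg_le_neg (Finset.sum_le_sum_of_subset_of_nonneg
        (Finset.filter_subset_filter _ (Finset.subset_insert _ _)) fun i _ _ => hx i)
    have h3 : x a * Real.exp (-(x a + ∑ k ∈ s, x k)) ≤
        Real.exp (-∑ k ∈ s, x k) - Real.exp (-(x a + ∑ k ∈ s, x k)) := by
      have h4 : Real.exp (-∑ k ∈ s, x k) = Real.exp (x a) * Real.exp (-(x a + ∑ k ∈ s, x k)) := by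
        rw [← Real.exp_add]; congr 1; ring
      rw [h4]
      nlinarith [Real.add_one_le_exp (x a), Real.exp_pos (-(x a + ∑ k ∈ s, x k))]
    rw [h1]
    linarith

lemma carlesonCond_iff_blaschke {Λ : ℕ → ℂ} : CarlesonCond Λ ↔ ∃ δ : ℝ, 0 < δ ∧
    ∀ n : ℕ, ∀ F : Finset ℕ, n ∉ F → δ ≤ ∏ k ∈ F, ‖blaschke (Λ k) (Λ n)‖ := Iff.rfl

lemma re_herglotz (w z : ℂ) (h : 1 - (starRingEnd ℂ) w * z ≠ 0) :
    ((1 + (starRingEnd ℂ) w * z) / (1 - (starRingEnd ℂ) w * z)).re =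
      (1 - ‖w‖ ^ 2 * ‖z‖ ^ 2) / ‖1 - (starRingEnd ℂ) w * z‖ ^ 2 := by
  have hu : ‖w‖ ^ 2 * ‖z‖ ^ 2 = Complex.normSq ((starRingEnd ℂ) w * z) := by
    rw [Complex.normSq_eq_norm_sq, norm_mul, RCLike.norm_conj, mul_pow]
  rw [hu]
  generalize (starRingEnd ℂ) w * z = u at *
  have h0 : Complex.normSq (1 - u) ≠ 0 := (Complex.normSq_pos.2 h).ne'
  rw [Complex.div_re, ← Complex.normSq_eq_norm_sq, ← add_div]
  congr 1
  simp only [Complex.normSq_apply, Complex.sub_re, Complex.sub_im, Complex.add_re, Complex.add_im,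
    Complex.one_re, Complex.one_im]
  ring

lemma sum_one_sub_sq_le {ι : Type*} (F : Finset ι) (ρ : ι → ℝ) (hρ : ∀ k ∈ F, 0 ≤ ρ k) {δ : ℝ}
    (hδ : 0 < δ) (h : δ ≤ ∏ k ∈ F, ρ k) : ∑ k ∈ F, (1 - ρ k ^ 2) ≤ -(2 * Real.log δ) := by
  have hpos : ∀ k ∈ F, 0 < ρ k := by
    intro k hk
    refine lt_of_le_of_ne (hρ k hk) fun h0 => ?_
    rw [Finset.prod_eq_zero hk h0.symm] at h
    linarith
  have h1 : ∑ k ∈ F, (1 - ρ k ^ 2) ≤ ∑ k ∈ F, -(2 * Real.log (ρ k)) := by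
    refine Finset.sum_le_sum fun k hk => ?_
    have := Real.log_le_sub_one_of_pos (pow_pos (hpos k hk) 2)
    rw [Real.log_pow] at this
    push_cast at this
    linarith
  refine h1.trans ?_
  rw [Finset.sum_neg_distrib, ← Finset.mul_sum, ← Real.log_prod fun k hk => (hpos k hk).ne']
  have := Real.log_le_log hδ h
  linarith

/-- Jones' interpolating functions for finite subfamilies of a Carleson sequence, with bounds
independent of the subfamily. -/
lemma exists_jones_family {Λ : ℕ → ℂ} (hΛ : ∀ n, ‖Λ n‖ < 1) (hC : CarlesonCond Λ) :
    ∃ M : ℝ, 0 < M ∧ ∀ F : Finset ℕ, ∃ G : ℕ → ℂ → ℂ,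
      (∀ n, DifferentiableOn ℂ (G n) (ball (0 : ℂ) 1)) ∧
      (∀ n ∈ F, ∀ k ∈ F, G n (Λ k) = if k = n then 1 else 0) ∧
      (∀ z : ℂ, ‖z‖ < 1 → ∑ n ∈ F, ‖G n z‖ ≤ M) ∧
      ∀ n ∈ F, ∀ z : ℂ, ‖z‖ < 1 →
        ‖G n z‖ ≤ M * ((1 - ‖Λ n‖ ^ 2) ^ 2 * ‖ev z (szego (Λ n))‖ ^ 2) := by
  obtain ⟨δ, hδ, hC⟩ := carlesonCond_iff_blaschke.1 hC
  set M₀ : ℝ := 2 * (1 + -(2 * Real.log δ)) with hM₀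
  refine ⟨δ⁻¹ * Real.exp M₀, by positivity, fun F => ?_⟩
  set D : ℕ → ℂ → ℂ := fun k z => 1 - (starRingEnd ℂ) (Λ k) * z with hD
  have hD0 : ∀ k, ∀ z : ℂ, ‖z‖ < 1 → D k z ≠ 0 := fun k z hz =>
    one_sub_conj_mul_ne_zero (hΛ k) hz.le
  have hDd : ∀ k, DifferentiableOn ℂ (D k) (ball (0 : ℂ) 1) := fun k => by fun_prop
  have hL : ∀ k, 0 < 1 - ‖Λ k‖ ^ 2 := fun k => one_sub_norm_sq_pos (hΛ k)
  set V : ℕ → ℂ → ℂ := fun n z => ∑ k ∈ F with ‖Λ n‖ ≤ ‖Λ k‖,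
    ((1 - ‖Λ k‖ ^ 2 : ℝ) : ℂ) * ((1 + (starRingEnd ℂ) (Λ k) * z) / D k z) with hV
  set x : ℂ → ℕ → ℝ := fun z k =>
    (1 - ‖Λ k‖ ^ 2) * ((1 - ‖Λ k‖ ^ 2 * ‖z‖ ^ 2) / ‖D k z‖ ^ 2) with hx
  have hx0 : ∀ z : ℂ, ‖z‖ < 1 → ∀ k, 0 ≤ x z k := by
    intro z hz k
    have h1 : 0 ≤ 1 - ‖Λ k‖ ^ 2 * ‖z‖ ^ 2 := by
      have := hL k
      have h2 := one_sub_norm_sq_pos hz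
      nlinarith [sq_nonneg ‖z‖]
    have := (hL k).le
    positivity
  have hVre : ∀ n, ∀ z : ℂ, ‖z‖ < 1 → (V n z).re = ∑ k ∈ F with ‖Λ n‖ ≤ ‖Λ k‖, x z k := by
    intro n z hz
    simp only [hV, Complex.re_sum]
    refine Finset.sum_congr rfl fun k _ => ?_
    rw [Complex.re_ofReal_mul, re_herglotz _ _ (hD0 k z hz)]
  have hVd : ∀ n, DifferentiableOn ℂ (V n) (ball (0 : ℂ) 1) := by
    intro n
    refine DifferentiableOn.fun_sum fun k _ => DifferentiableOn.const_mul ?_ _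
    exact DifferentiableOn.div (by fun_prop) (hDd k) fun z hz =>
      hD0 k z (mem_ball_zero_iff.1 hz)
  have hVΛ : ∀ n ∈ F, (V n (Λ n)).re ≤ M₀ := by
    intro n hn
    rw [hVre n _ (hΛ n)]
    calc ∑ k ∈ F with ‖Λ n‖ ≤ ‖Λ k‖, x (Λ n) k
        ≤ ∑ k ∈ F with ‖Λ n‖ ≤ ‖Λ k‖, 2 * (1 - ‖blaschke (Λ k) (Λ n)‖ ^ 2) := by
          refine Finset.sum_le_sum fun k hk => ?_
          rw [one_sub_norm_blaschke_sq (hΛ k) (hΛ n).le]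
          have hle : ‖Λ n‖ ^ 2 ≤ ‖Λ k‖ ^ 2 :=
            pow_le_pow_left₀ (norm_nonneg _) (Finset.mem_filter.1 hk).2 2
          have hD2 : 0 < ‖D k (Λ n)‖ ^ 2 := by
            have := norm_pos_iff.2 (hD0 k _ (hΛ n)); positivity
          have h1 : 1 - ‖Λ k‖ ^ 2 * ‖Λ n‖ ^ 2 ≤ 2 * (1 - ‖Λ n‖ ^ 2) := by
            nlinarith [sq_nonneg (1 - ‖Λ n‖ ^ 2), sq_nonneg ‖Λ n‖]
          simp only [hx]
          rw [← mul_div_assoc, ← mul_div_assoc]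
          refine div_le_div_of_nonneg_right ?_ hD2.le
          nlinarith [hL k]
      _ ≤ ∑ k ∈ F, 2 * (1 - ‖blaschke (Λ k) (Λ n)‖ ^ 2) := by
          refine Finset.sum_le_sum_of_subset_of_nonneg (Finset.filter_subset _ _) fun k _ _ => ?_
          have := norm_blaschke_le_one (hΛ k) (hΛ n).le
          nlinarith [norm_nonneg (blaschke (Λ k) (Λ n))]
      _ ≤ M₀ := by
          rw [← Finset.mul_sum, hM₀, ← Finset.add_sum_erase F _ hn]
          have h1 := sum_one_sub_sq_le (F.erase n) (fun k => ‖blaschke (Λ k) (Λ n)‖)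
            (fun _ _ => norm_nonneg _) hδ (hC n _ (Finset.notMem_erase n F))
          have h2 : 0 ≤ ‖blaschke (Λ n) (Λ n)‖ ^ 2 := by positivity
          linarith
  have hB : ∀ n, δ ≤ ‖∏ k ∈ F.erase n, blaschke (Λ k) (Λ n)‖ := fun n => by
    rw [norm_prod]; exact hC n _ (Finset.notMem_erase n F)
  have hB0 : ∀ n, ∏ k ∈ F.erase n, blaschke (Λ k) (Λ n) ≠ 0 := fun n h => by
    have := hB n
    rw [h, norm_zero] at this
    linarith
  set G : ℕ → ℂ → ℂ := fun n z =>
    ((∏ k ∈ F.erase n, blaschke (Λ k) z) / ∏ k ∈ F.erase n, blaschke (Λ k) (Λ n)) *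
      (((1 - ‖Λ n‖ ^ 2 : ℝ) : ℂ) / D n z) ^ 2 * Complex.exp (V n (Λ n) - V n z) with hG
  have hbound : ∀ n ∈ F, ∀ z : ℂ, ‖z‖ < 1 → ‖G n z‖ ≤ δ⁻¹ * Real.exp M₀ *
      ((1 - ‖Λ n‖ ^ 2) ^ 2 / ‖D n z‖ ^ 2 * Real.exp (-(V n z).re)) := by
    intro n hn z hz
    have h1 : ‖(∏ k ∈ F.erase n, blaschke (Λ k) z) / ∏ k ∈ F.erase n, blaschke (Λ k) (Λ n)‖ ≤
        δ⁻¹ := by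
      rw [norm_div, inv_eq_one_div]
      refine div_le_div₀ zero_le_one ?_ hδ (hB n)
      rw [norm_prod]
      exact Finset.prod_le_one (fun _ _ => norm_nonneg _) fun k _ =>
        norm_blaschke_le_one (hΛ k) hz.le
    have h2 : ‖Complex.exp (V n (Λ n) - V n z)‖ ≤ Real.exp M₀ * Real.exp (-(V n z).re) := by
      rw [Complex.norm_exp, Complex.sub_re, sub_eq_add_neg, Real.exp_add]
      exact mul_le_mul_of_nonneg_right (Real.exp_le_exp.2 (hVΛ n hn)) (Real.exp_pos _).le
    have h3 : ‖(((1 - ‖Λ n‖ ^ 2 : ℝ) : ℂ) / D n z) ^ 2‖ = (1 - ‖Λ n‖ ^ 2) ^ 2 / ‖D n z‖ ^ 2 := by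
      rw [norm_pow, norm_div, Complex.norm_real, Real.norm_of_nonneg (hL n).le, div_pow]
    simp only [hG]
    rw [norm_mul, norm_mul, h3]
    calc _ ≤ δ⁻¹ * ((1 - ‖Λ n‖ ^ 2) ^ 2 / ‖D n z‖ ^ 2) *
        (Real.exp M₀ * Real.exp (-(V n z).re)) := by gcongr
      _ = _ := by ring
  refine ⟨G, fun n => ?_, fun n hn k hk => ?_, fun z hz => ?_, fun n hn z hz => ?_⟩
  · refine DifferentiableOn.mul (DifferentiableOn.mul ?_ ?_) ?_
    · exact (DifferentiableOn.fun_finsetProd fun k _ => differentiableOn_blaschke (hΛ k)).div_const _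
    · refine DifferentiableOn.pow (DifferentiableOn.div (differentiableOn_const _) (hDd n) ?_) 2
      exact fun z hz => hD0 n z (mem_ball_zero_iff.1 hz)
    · exact ((differentiableOn_const _).sub (hVd n)).cexp
  · split_ifs with h
    · subst h
      have h1 : (((1 - ‖Λ k‖ ^ 2 : ℝ) : ℂ) / D k (Λ k)) = 1 := by
        have : D k (Λ k) = ((1 - ‖Λ k‖ ^ 2 : ℝ) : ℂ) := by
          simp only [hD, Complex.conj_mul']
          push_cast
          rfl
        rw [this, div_self]
        exact_mod_cast (hL k).ne'
      simp only [hG]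
      rw [h1, div_self (hB0 k)]
      simp
    · simp only [hG]
      rw [Finset.prod_eq_zero (Finset.mem_erase.2 ⟨h, hk⟩) (by simp [blaschke])]
      simp
  · calc ∑ n ∈ F, ‖G n z‖ ≤ ∑ n ∈ F, δ⁻¹ * Real.exp M₀ *
          (x z n * Real.exp (-∑ k ∈ F with ‖Λ n‖ ≤ ‖Λ k‖, x z k)) := by
          refine Finset.sum_le_sum fun n hn => (hbound n hn z hz).trans ?_
          rw [hVre n z hz]
          gcongr
          have h1 : 0 < ‖D n z‖ ^ 2 := by
            have := norm_pos_iff.2 (hD0 n z hz); positivity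
          simp only [hx]
          rw [← mul_div_assoc]
          refine div_le_div_of_nonneg_right ?_ h1.le
          have h2 := one_sub_norm_sq_pos hz
          nlinarith [hL n, mul_nonneg (hL n).le (mul_nonneg (sq_nonneg ‖Λ n‖) h2.le)]
      _ ≤ δ⁻¹ * Real.exp M₀ * 1 := by
          rw [← Finset.mul_sum]
          refine mul_le_mul_of_nonneg_left ?_ (by positivity)
          refine (sum_mul_exp_neg_le_one F (x z) (fun k => ‖Λ k‖) (hx0 z hz)).trans ?_
          linarith [Real.exp_pos (-∑ k ∈ F, x z k)]
      _ = _ := mul_one _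
  · refine (hbound n hn z hz).trans ?_
    rw [ev_szego_eq (hΛ n) hz, norm_inv, inv_pow, ← div_eq_mul_inv]
    refine mul_le_mul_of_nonneg_left ?_ (by positivity)
    refine mul_le_of_le_one_right (by positivity) (Real.exp_le_one_iff.2 ?_)
    rw [hVre n z hz, neg_nonpos]
    exact Finset.sum_nonneg fun k _ => hx0 z hz k

/-- Carleson's embedding theorem along a Carleson sequence. -/
lemma exists_sum_norm_ev_sq_le {Λ : ℕ → ℂ} (hΛ : ∀ n, ‖Λ n‖ < 1) (hC : CarlesonCond Λ) :
    ∃ M : ℝ, ∀ c : SqSeq, ∀ F : Finset ℕ,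
      ∑ n ∈ F, ‖ev (Λ n) c‖ ^ 2 * (1 - ‖Λ n‖ ^ 2) ≤ M * ‖c‖ ^ 2 := by
  obtain ⟨M, hM, h⟩ := exists_jones_family hΛ hC
  refine ⟨M ^ 2, fun c F => ?_⟩
  obtain ⟨G, hGd, hG, hGM, -⟩ := h F
  obtain ⟨d, hd, hd'⟩ := exists_ev_of_sum_sq_le (s := F) (t := {()})
    (f := fun n z => G n z * ev z c) (c := fun _ => c) (w := fun _ => M ^ 2)
    (fun _ _ => by positivity) (fun n _ => (hGd n).mul (differentiableOn_ev c)) (fun z hz => by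
      simp only [Finset.sum_singleton, norm_mul, mul_pow]
      rw [← Finset.sum_mul]
      refine mul_le_mul_of_nonneg_right ?_ (by positivity)
      calc ∑ n ∈ F, ‖G n z‖ ^ 2 ≤ (∑ n ∈ F, ‖G n z‖) ^ 2 :=
            Finset.sum_sq_le_sq_sum_of_nonneg fun _ _ => norm_nonneg _
        _ ≤ M ^ 2 := pow_le_pow_left₀ (Finset.sum_nonneg fun _ _ => norm_nonneg _) (hGM z hz) 2)
  rw [Finset.sum_singleton] at hd'
  refine le_trans (Finset.sum_le_sum fun n hn => ?_) hd'
  have h1 := norm_ev_sq_mul_le (hΛ n) (d n)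
  rwa [← hd n hn _ (hΛ n), hG n hn n hn, if_pos rfl, one_mul] at h1

/-- Free interpolation in `H²` along a Carleson sequence, with control of pointwise bounds. -/
lemma exists_interpolation {Λ : ℕ → ℂ} (hΛ : ∀ n, ‖Λ n‖ < 1) (hC : CarlesonCond Λ) :
    ∃ M : ℝ, 0 < M ∧ ∀ (c : ℕ → ℂ) (h : ℕ → ℂ → ℂ) (H : ℝ),
      (Summable fun n => ‖c n‖ ^ 2 * (1 - ‖Λ n‖ ^ 2)) →
      (∀ n, DifferentiableOn ℂ (h n) (ball (0 : ℂ) 1)) →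
      (∀ n, ∀ z : ℂ, ‖z‖ < 1 → ‖h n z‖ ≤ H) → (∀ n, h n (Λ n) = 1) →
      ∃ d : SqSeq, (∀ n, ev (Λ n) d = c n) ∧
        ∀ (A : ℂ → ℂ) (K : ℝ), (∀ n, ∀ z : ℂ, ‖z‖ < 1 → ‖A z * (c n * h n z)‖ ≤ K) →
          ∀ z : ℂ, ‖z‖ < 1 → ‖A z * ev z d‖ ≤ K * M := by
  obtain ⟨M, hM, hJ⟩ := exists_jones_family hΛ hC
  refine ⟨M, hM, fun c h H hc hd hH h1 => ?_⟩
  choose G hGd hG hGM hGs using fun i => hJ (Finset.range i)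
  set S := ∑' n, ‖c n‖ ^ 2 * (1 - ‖Λ n‖ ^ 2) with hS
  have hL : ∀ k, 0 < 1 - ‖Λ k‖ ^ 2 := fun k => one_sub_norm_sq_pos (hΛ k)
  have hex : ∀ i, ∃ d : SqSeq, ‖d‖ ^ 2 ≤ H ^ 2 * M ^ 2 * S ∧
      ∀ z : ℂ, ‖z‖ < 1 → ev z d = ∑ n ∈ Finset.range i, c n * h n z * G i n z := by
    intro i
    obtain ⟨d, hd1, hd2⟩ := exists_ev_of_sum_sq_le (s := {()}) (t := Finset.range i)
      (f := fun _ z => ∑ n ∈ Finset.range i, c n * h n z * G i n z)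
      (c := fun n => szego (Λ n))
      (w := fun n => H ^ 2 * M ^ 2 * (‖c n‖ ^ 2 * (1 - ‖Λ n‖ ^ 2) ^ 2))
      (fun _ _ => by positivity)
      (fun _ _ => DifferentiableOn.fun_sum fun n _ => ((hd n).const_mul _).mul (hGd i n))
      (fun z hz => by
        rw [Finset.sum_singleton]
        have e1 : ‖∑ n ∈ Finset.range i, c n * h n z * G i n z‖ ≤
            H * ∑ n ∈ Finset.range i, ‖c n‖ * ‖G i n z‖ := by
          refine (norm_sum_le _ _).trans ?_
          rw [Finset.mul_sum]
          refine Finset.sum_le_sum fun n _ => ?_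
          rw [norm_mul, norm_mul]
          have := hH n z hz
          calc ‖c n‖ * ‖h n z‖ * ‖G i n z‖ ≤ ‖c n‖ * H * ‖G i n z‖ := by gcongr
            _ = _ := by ring
        have e2 : (∑ n ∈ Finset.range i, ‖c n‖ * ‖G i n z‖) ^ 2 ≤
            (∑ n ∈ Finset.range i, ‖c n‖ ^ 2 * ‖G i n z‖) * ∑ n ∈ Finset.range i, ‖G i n z‖ := by
          refine Finset.sum_sq_le_sum_mul_sum_of_sq_le_mul _ (fun _ _ => by positivity)
            (fun _ _ => norm_nonneg _) fun n _ => le_of_eq ?_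
          ring
        calc ‖∑ n ∈ Finset.range i, c n * h n z * G i n z‖ ^ 2
            ≤ (H * ∑ n ∈ Finset.range i, ‖c n‖ * ‖G i n z‖) ^ 2 :=
              pow_le_pow_left₀ (norm_nonneg _) e1 2
          _ = H ^ 2 * (∑ n ∈ Finset.range i, ‖c n‖ * ‖G i n z‖) ^ 2 := by ring
          _ ≤ H ^ 2 * ((∑ n ∈ Finset.range i, ‖c n‖ ^ 2 * (M * ((1 - ‖Λ n‖ ^ 2) ^ 2 *
                ‖ev z (szego (Λ n))‖ ^ 2))) * M) := by
              refine mul_le_mul_of_nonneg_left (e2.trans ?_) (by positivity)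
              refine mul_le_mul (Finset.sum_le_sum fun n hn => ?_) (hGM i z hz)
                (Finset.sum_nonneg fun _ _ => norm_nonneg _)
                (Finset.sum_nonneg fun _ _ => by positivity)
              exact mul_le_mul_of_nonneg_left (hGs i n hn z hz) (by positivity)
          _ = _ := by
              rw [Finset.sum_mul, Finset.mul_sum]
              refine Finset.sum_congr rfl fun n _ => ?_
              ring)
    refine ⟨d (), ?_, fun z hz => (hd1 () (by simp) z hz).symm⟩
    rw [Finset.sum_singleton] at hd2
    refine hd2.trans ?_
    have e3 : ∀ n, H ^ 2 * M ^ 2 * (‖c n‖ ^ 2 * (1 - ‖Λ n‖ ^ 2) ^ 2) * ‖szego (Λ n)‖ ^ 2 =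
        H ^ 2 * M ^ 2 * (‖c n‖ ^ 2 * (1 - ‖Λ n‖ ^ 2)) := by
      intro n
      rw [norm_szego_sq (hΛ n)]
      have := (hL n).ne'
      field_simp
    simp_rw [e3]
    rw [← Finset.mul_sum]
    exact mul_le_mul_of_nonneg_left
      (hc.sum_le_tsum _ fun n _ => mul_nonneg (by positivity) (hL n).le) (by positivity)
  choose d hdn hdv using hex
  obtain ⟨x, U, hU, hUle, hx⟩ := exists_weak_limit (x := d) (C := √(H ^ 2 * M ^ 2 * S))
    fun i => Real.le_sqrt_of_sq_le (hdn i)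
  refine ⟨x, fun n => ?_, fun A K hK z hz => ?_⟩
  · refine tendsto_nhds_unique (hx (Λ n)) ?_
    refine tendsto_const_nhds.congr' (hUle ?_)
    filter_upwards [eventually_gt_atTop n] with i hi
    have hmem := Finset.mem_range.2 hi
    rw [hdv i _ (hΛ n), Finset.sum_eq_single_of_mem n hmem]
    · rw [hG i n hmem n hmem, if_pos rfl, h1 n, mul_one, mul_one]
    · intro k hk hkn
      rw [hG i k hk n hmem, if_neg hkn.symm, mul_zero]
  · refine le_of_tendsto ((hx z).const_mul (A z)).norm (Eventually.of_forall fun i => ?_)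
    rw [hdv i z hz, Finset.mul_sum]
    refine (norm_sum_le _ _).trans ?_
    have hK0 : 0 ≤ K := (norm_nonneg _).trans (hK 0 z hz)
    calc ∑ n ∈ Finset.range i, ‖A z * (c n * h n z * G i n z)‖
        ≤ ∑ n ∈ Finset.range i, K * ‖G i n z‖ := by
          refine Finset.sum_le_sum fun n _ => ?_
          rw [← mul_assoc, norm_mul]
          exact mul_le_mul_of_nonneg_right (hK n z hz) (norm_nonneg _)
      _ ≤ K * M := by
          rw [← Finset.mul_sum]
          exact mul_le_mul_of_nonneg_left (hGM i z hz) hK0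
/-- If a system of bounded linear equations `α i x = β i y` is solvable in `x` for every `y`,
then it is solvable with a norm bound. -/
lemma exists_norm_le_of_solvable {ι E F : Type*} [NormedAddCommGroup E] [NormedSpace ℂ E]
    [CompleteSpace E] [NormedAddCommGroup F] [NormedSpace ℂ F] [CompleteSpace F]
    (α : ι → E →L[ℂ] ℂ) (β : ι → F →L[ℂ] ℂ) (h : ∀ y, ∃ x, ∀ i, α i x = β i y) :
    ∃ C : ℝ, 0 < C ∧ ∀ y, ∃ x, (∀ i, α i x = β i y) ∧ ‖x‖ ≤ C * ‖y‖ := by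
  let T : ι → E × F →L[ℂ] ℂ := fun i =>
    (α i).comp (ContinuousLinearMap.fst ℂ E F) - (β i).comp (ContinuousLinearMap.snd ℂ E F)
  let S : Submodule ℂ (E × F) := ⨅ i, (T i).ker
  have hmem : ∀ q : E × F, q ∈ S ↔ ∀ i, α i q.1 = β i q.2 := by
    intro q
    simp only [S, Submodule.mem_iInf, LinearMap.mem_ker]
    exact forall_congr' fun i => sub_eq_zero
  have hS : IsClosed (S : Set (E × F)) := by
    have : (S : Set (E × F)) = ⋂ i, {q | T i q = 0} := by
      ext q
      simp [S]
    rw [this]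
    exact isClosed_iInter fun i => isClosed_eq (T i).continuous continuous_const
  have : CompleteSpace S := hS.completeSpace_coe
  obtain ⟨C, hC, hT⟩ := ContinuousLinearMap.exists_preimage_norm_le
    ((ContinuousLinearMap.snd ℂ E F).comp S.subtypeL) (fun y => by
      obtain ⟨x, hx⟩ := h y
      exact ⟨⟨(x, y), (hmem _).2 hx⟩, rfl⟩)
  refine ⟨C, hC, fun y => ?_⟩
  obtain ⟨⟨⟨x, y'⟩, hq⟩, rfl, hle⟩ := hT y
  exact ⟨x, (hmem _).1 hq, (norm_fst_le _).trans hle⟩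

/-- If all bounded sequences act by multiplication on the restrictions of `H²` functions to
`Λ`, then `Λ` is a Carleson sequence. -/
lemma carlesonCond_of_mul {Λ : ℕ → ℂ} (hΛ : ∀ n, ‖Λ n‖ < 1)
    (h : ∀ v : ℕ → ℂ, (∃ C, ∀ n, ‖v n‖ ≤ C) → ∀ c : SqSeq, ∃ d : SqSeq,
      ∀ n, ev (Λ n) d = v n * ev (Λ n) c) : CarlesonCond Λ := by
  classical
  have hv : ∀ n k, ‖(Pi.single n 1 : ℕ → ℂ) k‖ ≤ 1 := by
    intro n k
    by_cases hk : k = n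
    · subst hk; simp
    · simp [hk]
  have hinj : Function.Injective Λ := by
    intro n k hnk
    by_contra hne
    obtain ⟨c, -, hc⟩ := exists_ev_eval 1
    obtain ⟨d, hd⟩ := h (Pi.single n 1) ⟨1, hv n⟩ c
    have h1 := hd n
    have h2 := hd k
    rw [← hc _ (hΛ n)] at h1
    rw [← hnk, h1, ← hc _ (hΛ n)] at h2
    simp [Ne.symm hne] at h2
  have hb : ∀ c : SqSeq, ∃ C, ∀ i : {q : ℕ × Finset ℕ // q.1 ∉ q.2},
      ‖(((√(1 - ‖Λ i.1.1‖ ^ 2) / ∏ k ∈ i.1.2, ‖blaschke (Λ k) (Λ i.1.1)‖ : ℝ) : ℂ) •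
        ev (Λ i.1.1)) c‖ ≤ C := by
    intro c
    obtain ⟨C, hC, hs⟩ := exists_norm_le_of_solvable (E := SqSeq)
      (F := BoundedContinuousFunction ℕ ℂ) (fun n => ev (Λ n))
      (fun n => ev (Λ n) c • BoundedContinuousFunction.evalCLM ℂ n) (fun v => by
        obtain ⟨d, hd⟩ := h v ⟨‖v‖, v.norm_coe_le_norm⟩ c
        exact ⟨d, fun n => by rw [hd n, mul_comm]; rfl⟩)
    refine ⟨C, fun ⟨⟨n, F⟩, hnF⟩ => ?_⟩
    obtain ⟨d, hd, hdn⟩ := hs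
      (BoundedContinuousFunction.ofNormedAddCommGroupDiscrete (Pi.single n 1) 1 (hv n))
    have hdn' : ‖d‖ ≤ C := hdn.trans (mul_le_of_le_one_right hC.le
      ((BoundedContinuousFunction.norm_le zero_le_one).2 (hv n)))
    have hd' : ∀ k, ev (Λ k) d = ev (Λ k) c * (Pi.single n 1 : ℕ → ℂ) k := hd
    have h1 := norm_ev_sq_mul_le_prod hΛ hinj (c := d) F (fun k hk => by
      rw [hd' k, Pi.single_eq_of_ne (ne_of_mem_of_not_mem hk hnF), mul_zero]) (hΛ n)
    rw [hd' n, Pi.single_eq_same, mul_one] at h1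
    have hP : 0 < ∏ k ∈ F, ‖blaschke (Λ k) (Λ n)‖ := Finset.prod_pos fun k hk =>
      norm_pos_iff.2 (blaschke_ne_zero (hΛ k) (hΛ n) fun e =>
        ne_of_mem_of_not_mem hk hnF (hinj e).symm)
    have hL := one_sub_norm_sq_pos (hΛ n)
    have h2 : √(1 - ‖Λ n‖ ^ 2) * ‖ev (Λ n) c‖ ≤ C * ∏ k ∈ F, ‖blaschke (Λ k) (Λ n)‖ := by
      refine le_of_sq_le_sq ?_ (by positivity)
      rw [mul_pow, Real.sq_sqrt hL.le, mul_pow, mul_comm]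
      refine h1.trans ?_
      gcongr
    rw [_root_.smul_apply, norm_smul, Complex.norm_real,
      Real.norm_of_nonneg (by positivity), div_mul_eq_mul_div]
    exact (div_le_iff₀ hP).2 h2
  obtain ⟨C, hC⟩ := banach_steinhaus hb
  refine carlesonCond_iff_blaschke.2 ⟨(max C 1)⁻¹, by positivity, fun n F hnF => ?_⟩
  have hP : 0 < ∏ k ∈ F, ‖blaschke (Λ k) (Λ n)‖ := Finset.prod_pos fun k hk =>
    norm_pos_iff.2 (blaschke_ne_zero (hΛ k) (hΛ n) fun e =>
      ne_of_mem_of_not_mem hk hnF (hinj e).symm)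
  have hL := one_sub_norm_sq_pos (hΛ n)
  have h1 := ContinuousLinearMap.le_of_opNorm_le _ ((hC ⟨(n, F), hnF⟩).trans (le_max_left C 1))
    (szego (Λ n))
  have hs : ‖szego (Λ n)‖ = (√(1 - ‖Λ n‖ ^ 2))⁻¹ := by
    rw [← Real.sqrt_inv, ← norm_szego_sq (hΛ n), Real.sqrt_sq (norm_nonneg _)]
  rw [_root_.smul_apply, norm_smul, Complex.norm_real,
      Real.norm_of_nonneg (by positivity), ev_szego (hΛ n), Complex.norm_real,
      Real.norm_of_nonneg (by positivity), hs] at h1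
  dsimp only at h1
  have hsq : 0 < √(1 - ‖Λ n‖ ^ 2) := Real.sqrt_pos.2 hL
  refine inv_le_of_inv_le₀ hP ?_
  rw [← Real.sq_sqrt hL.le] at h1
  set s := √(1 - ‖Λ n‖ ^ 2)
  rw [Real.sqrt_sq hsq.le] at h1
  field_simp at h1
  rw [inv_eq_one_div]
  exact (div_le_iff₀ hP).2 (by linarith)

/-- A divergent series of nonnegative terms can be split into two divergent subseries. -/
lemma exists_not_summable_indicator {f : ℕ → ℝ} (hf : ∀ n, 0 ≤ f n) (h : ¬ Summable f) :
    ∃ A : Set ℕ, ¬ Summable (A.indicator f) ∧ ¬ Summable (Aᶜ.indicator f) := by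
  have hex : ∀ n, ∃ k, n ≤ k ∧ 1 ≤ ∑ i ∈ Finset.Ico n k, f i := by
    intro n
    have h1 := (not_summable_iff_tendsto_nat_atTop_of_nonneg hf).1 h
    obtain ⟨k, hk, hnk⟩ := ((h1.eventually_ge_atTop
      (1 + ∑ i ∈ Finset.range n, f i)).and (eventually_ge_atTop n)).exists
    refine ⟨k, hnk, ?_⟩
    rw [Finset.sum_Ico_eq_sub _ hnk]
    linarith
  choose e hle he using hex
  have hlt : ∀ n, n < e n := fun n => lt_of_le_of_ne (hle n) fun heq => by
    have := he n
    rw [← heq, Finset.Ico_self, Finset.sum_empty] at this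
    linarith
  set u : ℕ → ℕ := fun k => e^[k] 0 with hu
  have hsucc : ∀ k, u (k + 1) = e (u k) := fun k => Function.iterate_succ_apply' e k 0
  have hmono : StrictMono u := strictMono_nat_of_lt_succ fun k => by
    rw [hsucc]; exact hlt _
  have key : ∀ A : Set ℕ, (∀ n, ∃ k, n ≤ k ∧ ∀ i ∈ Finset.Ico (u k) (u (k + 1)), i ∈ A) →
      ¬ Summable (A.indicator f) := by
    intro A hA hs
    obtain ⟨s, hs⟩ := summable_iff_vanishing.1 hs (Set.Iio 1) (Iio_mem_nhds one_pos)
    obtain ⟨n, hn⟩ := s.bddAbove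
    obtain ⟨k, hk, hkA⟩ := hA (n + 1)
    have h1 := hs (Finset.Ico (u k) (u (k + 1))) (Finset.disjoint_left.2 fun i hi his => by
      have h2 := hn his
      have h3 := (Finset.mem_Ico.1 hi).1
      have h4 := hmono.id_le k
      simp only [id] at h4
      omega)
    rw [Finset.sum_congr rfl fun i hi => Set.indicator_of_mem (hkA i hi) f, Set.mem_Iio,
      hsucc] at h1
    linarith [he (u k)]
  refine ⟨{n | ∃ k, u (2 * k) ≤ n ∧ n < u (2 * k + 1)}, key _ fun n => ?_, key _ fun n => ?_⟩
  · exact ⟨2 * n, by omega, fun i hi => ⟨n, Finset.mem_Ico.1 hi⟩⟩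
  · refine ⟨2 * n + 1, by omega, fun i hi => ?_⟩
    rintro ⟨k, hk1, hk2⟩
    rw [Finset.mem_Ico] at hi
    have h1 := hmono.lt_iff_lt.1 (hi.1.trans_lt hk2)
    have h2 := hmono.lt_iff_lt.1 (hk1.trans_lt hi.2)
    omega

/-- The polynomial with zeros `ζ j` of multiplicities `m j`. -/
def zeroPoly {l : ℕ} (ζ : Fin l → ℂ) (m : Fin l → ℕ) : Polynomial ℂ :=
  ∏ j, (Polynomial.X - Polynomial.C (ζ j)) ^ m j

section ZeroPoly

variable {l : ℕ} {ζ : Fin l → ℂ} {m : Fin l → ℕ}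

lemma eval_zeroPoly (ζ : Fin l → ℂ) (m : Fin l → ℕ) (z : ℂ) :
    (zeroPoly ζ m).eval z = ∏ j, (z - ζ j) ^ m j := by
  simp [zeroPoly, Polynomial.eval_prod]

lemma eval_zeroPoly_ne_zero (hζ : ∀ j, ‖ζ j‖ = 1) {z : ℂ} (hz : ‖z‖ < 1) :
    (zeroPoly ζ m).eval z ≠ 0 := by
  rw [eval_zeroPoly]
  refine Finset.prod_ne_zero_iff.2 fun j _ => pow_ne_zero _ (sub_ne_zero.2 ?_)
  rintro rfl
  exact hz.ne (hζ j)

lemma eval_zeroPoly_eq_zero_iff (hm : ∀ j, 1 ≤ m j) {z : ℂ} :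
    (zeroPoly ζ m).eval z = 0 ↔ ∃ j, z = ζ j := by
  rw [eval_zeroPoly, Finset.prod_eq_zero_iff]
  constructor
  · rintro ⟨j, -, h⟩
    exact ⟨j, sub_eq_zero.1 (eq_zero_of_pow_eq_zero h)⟩
  · rintro ⟨j, rfl⟩
    exact ⟨j, Finset.mem_univ _, by rw [sub_self, zero_pow (by have := hm j; omega)]⟩

lemma exists_norm_eval_zeroPoly_le (ζ : Fin l → ℂ) (m : Fin l → ℕ) :
    ∃ C : ℝ, 0 < C ∧ ∀ j, ∀ z : ℂ, ‖z‖ ≤ 1 →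
      ‖(zeroPoly ζ m).eval z‖ ≤ C * ‖ζ j - z‖ ^ m j := by
  classical
  have h : ∀ j, ∃ C : ℝ, 0 < C ∧ ∀ z : ℂ, ‖z‖ ≤ 1 →
      ‖(zeroPoly ζ m).eval z‖ ≤ C * ‖ζ j - z‖ ^ m j := by
    intro j
    set q : Polynomial ℂ := ∏ i ∈ Finset.univ.erase j,
      (Polynomial.X - Polynomial.C (ζ i)) ^ m i with hq
    refine ⟨∑ k ∈ q.support, ‖q.coeff k‖ + 1, by positivity, fun z hz => ?_⟩
    have h1 : zeroPoly ζ m = (Polynomial.X - Polynomial.C (ζ j)) ^ m j * q :=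
      (Finset.mul_prod_erase _ _ (Finset.mem_univ j)).symm
    rw [h1, Polynomial.eval_mul, norm_mul, Polynomial.eval_pow, norm_pow, mul_comm]
    have h2 := norm_eval_le q hz
    simp only [Polynomial.eval_sub, Polynomial.eval_X, Polynomial.eval_C, norm_sub_rev z]
    gcongr
    linarith
  choose C hC hle using h
  refine ⟨∑ j, C j + 1, by
    have : 0 ≤ ∑ j, C j := Finset.sum_nonneg fun j _ => (hC j).le
    positivity, fun j z hz => (hle j z hz).trans ?_⟩
  have : C j ≤ ∑ j, C j := Finset.single_le_sum (fun j _ => (hC j).le) (Finset.mem_univ j)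
  gcongr
  linarith

lemma exists_inv_norm_eval_zeroPoly_sq_le [Nonempty (Fin l)] (hζ : ∀ j, ‖ζ j‖ = 1)
    (hζinj : Function.Injective ζ) :
    ∃ C : ℝ, 0 ≤ C ∧ ∀ z : ℂ, ‖z‖ < 1 →
      1 / ‖(zeroPoly ζ m).eval z‖ ^ 2 ≤ C * ∑ j, 1 / ‖ζ j - z‖ ^ (2 * m j) := by
  classical
  have hcop : Pairwise (Function.onFun IsCoprime fun j =>
      (Polynomial.X - Polynomial.C (ζ j)) ^ m j) := fun i j hij =>
    (Polynomial.pairwise_coprime_X_sub_C hζinj hij).pow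
  obtain ⟨μ, hμ⟩ := exists_sum_eq_one_iff_pairwise_coprime'.2 hcop
  set B : Fin l → ℝ := fun j => ∑ k ∈ (μ j).support, ‖(μ j).coeff k‖ with hB
  refine ⟨∑ j, B j ^ 2, by positivity, fun z hz => ?_⟩
  have hne : ∀ j, 0 < ‖ζ j - z‖ := fun j => norm_pos_iff.2 (sub_ne_zero.2 fun h => by
    rw [← h, hζ j] at hz; exact lt_irrefl _ hz)
  have ha : 0 < ‖(zeroPoly ζ m).eval z‖ := norm_pos_iff.2 (eval_zeroPoly_ne_zero hζ hz)
  have h1 : 1 / ‖(zeroPoly ζ m).eval z‖ ≤ ∑ j, B j * (1 / ‖ζ j - z‖ ^ m j) := by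
    rw [div_le_iff₀ ha, Finset.sum_mul]
    have h2 : ‖∑ j, (μ j * ∏ i ∈ {j}ᶜ, (Polynomial.X - Polynomial.C (ζ i)) ^ m i).eval z‖ = 1 := by
      rw [← Polynomial.eval_finsetSum, hμ, Polynomial.eval_one, norm_one]
    refine h2.symm.le.trans ((norm_sum_le _ _).trans (Finset.sum_le_sum fun j _ => ?_))
    have h3 : zeroPoly ζ m = (Polynomial.X - Polynomial.C (ζ j)) ^ m j *
        ∏ i ∈ {j}ᶜ, (Polynomial.X - Polynomial.C (ζ i)) ^ m i :=
      Fintype.prod_eq_mul_prod_compl j _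
    rw [h3, Polynomial.eval_mul, Polynomial.eval_mul, norm_mul, norm_mul, Polynomial.eval_pow,
      norm_pow]
    simp only [Polynomial.eval_sub, Polynomial.eval_X, Polynomial.eval_C, norm_sub_rev z]
    have h4 := (pow_pos (hne j) (m j)).ne'
    rw [mul_assoc, ← mul_assoc (1 / _), one_div_mul_cancel h4, one_mul]
    exact mul_le_mul_of_nonneg_right (norm_eval_le _ hz.le) (norm_nonneg _)
  calc 1 / ‖(zeroPoly ζ m).eval z‖ ^ 2 = (1 / ‖(zeroPoly ζ m).eval z‖) ^ 2 := by
        rw [div_pow, one_pow]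
    _ ≤ (∑ j, B j * (1 / ‖ζ j - z‖ ^ m j)) ^ 2 := pow_le_pow_left₀ (by positivity) h1 2
    _ ≤ (∑ j, B j ^ 2) * ∑ j, (1 / ‖ζ j - z‖ ^ m j) ^ 2 := Finset.sum_mul_sq_le_sq_mul_sq _ _ _
    _ = _ := by
        congr 1
        refine Finset.sum_congr rfl fun j _ => ?_
        rw [div_pow, one_pow, ← pow_mul, mul_comm (m j)]

/-- The summability conditions at the individual zeros amount to a single one. -/
lemma summable_div_norm_eval_zeroPoly_iff [Nonempty (Fin l)] (hζ : ∀ j, ‖ζ j‖ = 1)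
    (hζinj : Function.Injective ζ) {Λ : ℕ → ℂ} (hΛ : ∀ n, ‖Λ n‖ < 1) :
    (Summable fun n => (1 - ‖Λ n‖ ^ 2) / ‖(zeroPoly ζ m).eval (Λ n)‖ ^ 2) ↔
      ∀ j, Summable fun n => (1 - ‖Λ n‖ ^ 2) / ‖ζ j - Λ n‖ ^ (2 * m j) := by
  have hL : ∀ n, 0 ≤ 1 - ‖Λ n‖ ^ 2 := fun n => (one_sub_norm_sq_pos (hΛ n)).le
  constructor
  · intro h j
    obtain ⟨C, hC, hle⟩ := exists_norm_eval_zeroPoly_le ζ m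
    refine Summable.of_nonneg_of_le (fun n => div_nonneg (hL n) (by positivity)) (fun n => ?_)
      (h.mul_left (C ^ 2))
    have h1 : 0 < ‖(zeroPoly ζ m).eval (Λ n)‖ := norm_pos_iff.2 (eval_zeroPoly_ne_zero hζ (hΛ n))
    have h2 : 0 < ‖ζ j - Λ n‖ := norm_pos_iff.2 (sub_ne_zero.2 fun h => by
      have := hΛ n
      rw [← h, hζ j] at this; exact lt_irrefl _ this)
    have h3 := pow_le_pow_left₀ h1.le (hle j _ (hΛ n).le) 2
    rw [mul_pow, ← pow_mul, mul_comm (m j)] at h3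
    rw [← mul_div_assoc, div_le_div_iff₀ (by positivity) (by positivity)]
    nlinarith [hL n]
  · intro h
    obtain ⟨C, hC, hle⟩ := exists_inv_norm_eval_zeroPoly_sq_le (m := m) hζ hζinj
    refine Summable.of_nonneg_of_le (fun n => div_nonneg (hL n) (by positivity)) (fun n => ?_)
      ((summable_sum fun j (_ : j ∈ Finset.univ) => h j).mul_left C)
    rw [div_eq_mul_one_div]
    refine (mul_le_mul_of_nonneg_left (hle _ (hΛ n)) (hL n)).trans (le_of_eq ?_)
    rw [mul_left_comm, Finset.mul_sum]
    simp only [mul_one_div]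

end ZeroPoly

section Rational

variable {P Q : Polynomial ℂ}

lemma exists_norm_eval_div_sub_le (hQ : ∀ z : ℂ, ‖z‖ ≤ 1 → Q.eval z ≠ 0) :
    ∃ L : ℝ, 0 ≤ L ∧ ∀ z w : ℂ, ‖z‖ ≤ 1 → ‖w‖ ≤ 1 →
      ‖P.eval z / Q.eval z - P.eval w / Q.eval w‖ ≤ L * ‖z - w‖ := by
  have hQ' : ∀ z ∈ closedBall (0 : ℂ) 1, Q.eval z ≠ 0 := fun z hz =>
    hQ z (mem_closedBall_zero_iff.1 hz)
  obtain ⟨C, hC⟩ := (isCompact_closedBall (0 : ℂ) 1).exists_bound_of_continuousOn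
    (f := fun z => (P.derivative.eval z * Q.eval z - P.eval z * Q.derivative.eval z) /
      Q.eval z ^ 2)
    (ContinuousOn.div (by fun_prop) (by fun_prop) fun z hz => pow_ne_zero 2 (hQ' z hz))
  refine ⟨C, (norm_nonneg _).trans (hC 0 (by simp)), fun z w hz hw => ?_⟩
  exact Convex.norm_image_sub_le_of_norm_hasDerivWithin_le
    (f := fun z => P.eval z / Q.eval z)
    (fun z hz => ((P.hasDerivAt z).div (Q.hasDerivAt z) (hQ' z hz)).hasDerivWithinAt) hC
    (convex_closedBall _ _) (mem_closedBall_zero_iff.2 hw) (mem_closedBall_zero_iff.2 hz)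

lemma diffContOnCl_eval_div (hQ : ∀ z : ℂ, ‖z‖ ≤ 1 → Q.eval z ≠ 0) :
    DiffContOnCl ℂ (fun z => P.eval z / Q.eval z) (ball (0 : ℂ) 1) :=
  DiffContOnCl.mk_ball
    (DifferentiableOn.div (by fun_prop) (by fun_prop) fun z hz => hQ z (mem_ball_zero_iff.1 hz).le)
    (ContinuousOn.div (by fun_prop) (by fun_prop) fun z hz => hQ z (mem_closedBall_zero_iff.1 hz))

lemma exists_le_norm_eval_div (hP : ∀ z : ℂ, ‖z‖ ≤ 1 → P.eval z ≠ 0)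
    (hQ : ∀ z : ℂ, ‖z‖ ≤ 1 → Q.eval z ≠ 0) :
    ∃ c C : ℝ, 0 < c ∧ 0 < C ∧ ∀ z : ℂ, ‖z‖ ≤ 1 →
      c ≤ ‖P.eval z / Q.eval z‖ ∧ ‖P.eval z / Q.eval z‖ ≤ C := by
  have hcont : ∀ {P Q : Polynomial ℂ}, (∀ z : ℂ, ‖z‖ ≤ 1 → Q.eval z ≠ 0) →
      ∃ C : ℝ, 0 < C ∧ ∀ z : ℂ, ‖z‖ ≤ 1 → ‖P.eval z / Q.eval z‖ ≤ C := by
    intro P Q hQ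
    obtain ⟨C, hC⟩ := (isCompact_closedBall (0 : ℂ) 1).exists_bound_of_continuousOn
      (f := fun z => P.eval z / Q.eval z)
      (ContinuousOn.div (by fun_prop) (by fun_prop) fun z hz => hQ z (mem_closedBall_zero_iff.1 hz))
    exact ⟨max C 1, by positivity, fun z hz =>
      (hC z (mem_closedBall_zero_iff.2 hz)).trans (le_max_left _ _)⟩
  obtain ⟨C, hC, h1⟩ := hcont (P := P) hQ
  obtain ⟨D, hD, h2⟩ := hcont (P := Q) hP
  refine ⟨D⁻¹, C, by positivity, hC, fun z hz => ⟨?_, h1 z hz⟩⟩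
  have h3 := h2 z hz
  rw [← inv_div, norm_inv] at h3
  exact inv_le_of_inv_le₀ (norm_pos_iff.2 (div_ne_zero (hP z hz) (hQ z hz))) h3

end Rational

lemma norm_sq_add_norm_sq_le_one {a b : ℂ → ℂ} (ha : DiffContOnCl ℂ a (ball (0 : ℂ) 1))
    (hb : DiffContOnCl ℂ b (ball (0 : ℂ) 1))
    (hab : ∀ z : ℂ, ‖z‖ = 1 → ‖a z‖ ^ 2 + ‖b z‖ ^ 2 = 1) {z : ℂ} (hz : ‖z‖ < 1) :
    ‖a z‖ ^ 2 + ‖b z‖ ^ 2 ≤ 1 := by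
  set S := ‖a z‖ ^ 2 + ‖b z‖ ^ 2 with hS
  have hS0 : 0 ≤ S := by positivity
  have h1 := Complex.norm_le_of_forall_mem_frontier_norm_le isBounded_ball
    (f := fun w => (starRingEnd ℂ) (a z) * a w + (starRingEnd ℂ) (b z) * b w)
    ((ha.const_smul ((starRingEnd ℂ) (a z))).add (hb.const_smul ((starRingEnd ℂ) (b z))))
    (C := √S) (fun w hw => by
      rw [frontier_ball _ one_ne_zero, mem_sphere_zero_iff_norm] at hw
      refine Real.le_sqrt_of_sq_le ?_
      have h2 : ‖(starRingEnd ℂ) (a z) * a w + (starRingEnd ℂ) (b z) * b w‖ ≤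
          ‖a z‖ * ‖a w‖ + ‖b z‖ * ‖b w‖ := by
        refine (norm_add_le _ _).trans (le_of_eq ?_)
        rw [norm_mul, norm_mul, RCLike.norm_conj, RCLike.norm_conj]
      refine (pow_le_pow_left₀ (norm_nonneg _) h2 2).trans ?_
      have h3 := hab w hw
      rw [hS, ← mul_one (‖a z‖ ^ 2 + ‖b z‖ ^ 2), ← h3]
      nlinarith [sq_nonneg (‖a z‖ * ‖b w‖ - ‖b z‖ * ‖a w‖)])
    (subset_closure (mem_ball_zero_iff.2 hz))
  have h4 : (starRingEnd ℂ) (a z) * a z + (starRingEnd ℂ) (b z) * b z = (S : ℂ) := by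
    rw [Complex.conj_mul', Complex.conj_mul', hS]
    push_cast
    rfl
  rw [h4, Complex.norm_real, Real.norm_of_nonneg hS0] at h1
  have h5 := Real.sq_sqrt hS0
  have h6 := Real.sqrt_nonneg S
  by_contra! h7
  have h8 : 1 < √S := by
    rw [Real.lt_sqrt zero_le_one]; linarith
  nlinarith

lemma one_sub_norm_sq_le_of_norm_le_one {b : ℂ → ℂ}
    (hb : DifferentiableOn ℂ b (ball (0 : ℂ) 1)) (hb1 : ∀ z : ℂ, ‖z‖ < 1 → ‖b z‖ ≤ 1)
    (hb0 : ‖b 0‖ < 1) {z : ℂ} (hz : ‖z‖ < 1) :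
    (1 - ‖b 0‖) ^ 2 * (1 - ‖z‖ ^ 2) ≤ 1 - ‖b z‖ ^ 2 := by
  have h1 := Complex.norm_le_norm_of_mapsTo_ball (R := 1) (f := fun z => blaschke (b 0) (b z))
    (by
      unfold blaschke
      exact DifferentiableOn.div (hb.sub_const _) ((hb.const_mul _).const_sub _) fun w hw =>
        one_sub_conj_mul_ne_zero hb0 (hb1 w (mem_ball_zero_iff.1 hw)))
    (fun w hw => mem_closedBall_zero_iff.2
      (norm_blaschke_le_one hb0 (hb1 w (mem_ball_zero_iff.1 hw))))
    (by simp [blaschke]) hz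
  have h2 := one_sub_norm_blaschke_sq hb0 (hb1 z hz)
  have h3 : 1 - ‖z‖ ^ 2 ≤ 1 - ‖blaschke (b 0) (b z)‖ ^ 2 := by
    have := pow_le_pow_left₀ (norm_nonneg _) h1 2
    linarith
  have h4 : 1 - ‖b 0‖ ≤ ‖1 - (starRingEnd ℂ) (b 0) * b z‖ := by
    have h5 := norm_sub_norm_le (1 : ℂ) ((starRingEnd ℂ) (b 0) * b z)
    rw [norm_one, norm_mul, RCLike.norm_conj] at h5
    have := mul_le_of_le_one_right (norm_nonneg (b 0)) (hb1 z hz)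
    linarith
  have h6 : 0 < 1 - ‖b 0‖ := by linarith
  have h7 := pow_le_pow_left₀ h6.le h4 2
  have h8 : 0 ≤ 1 - ‖b z‖ ^ 2 := by nlinarith [hb1 z hz, norm_nonneg (b z)]
  rw [h2, le_div_iff₀ (by nlinarith)] at h3
  have h9 : (1 - ‖z‖ ^ 2) * (1 - ‖b 0‖) ^ 2 ≤ (1 - ‖b 0‖ ^ 2) * (1 - ‖b z‖ ^ 2) :=
    (mul_le_mul_of_nonneg_left h7 (one_sub_norm_sq_pos hz).le).trans h3
  nlinarith [sq_nonneg ‖b 0‖]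

lemma exists_norm_eq_one_norm_sub_eq {z : ℂ} (hz : ‖z‖ ≤ 1) :
    ∃ ω : ℂ, ‖ω‖ = 1 ∧ ‖z - ω‖ = 1 - ‖z‖ := by
  obtain rfl | h0 := eq_or_ne z 0
  · exact ⟨1, by simp, by simp⟩
  · have hn : 0 < ‖z‖ := norm_pos_iff.2 h0
    have hω : ‖z / (‖z‖ : ℂ)‖ = 1 := by
      rw [norm_div, Complex.norm_real, norm_norm, div_self hn.ne']
    refine ⟨z / (‖z‖ : ℂ), hω, ?_⟩
    have h1 : z - z / (‖z‖ : ℂ) = -(((1 - ‖z‖ : ℝ) : ℂ) * (z / (‖z‖ : ℂ))) := by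
      have : (‖z‖ : ℂ) ≠ 0 := by exact_mod_cast hn.ne'
      push_cast
      field_simp
      ring
    rw [h1, norm_neg, norm_mul, hω, mul_one, Complex.norm_real, Real.norm_of_nonneg (by linarith)]

/-- Near the boundary, `1 - |b|²` is comparable to `|∏ (z - ζ j) ^ m j|² + (1 - |z|²)`. -/
lemma exists_one_sub_norm_sq_bounds {b a : ℂ → ℂ} {l : ℕ} {ζ : Fin l → ℂ} {m : Fin l → ℕ}
    (hζ : ∀ j, ‖ζ j‖ = 1)
    (hb_rat : ∃ P Q : Polynomial ℂ, (∀ z : ℂ, ‖z‖ ≤ 1 → Q.eval z ≠ 0) ∧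
      ∀ z : ℂ, ‖z‖ ≤ 1 → b z = P.eval z / Q.eval z)
    (hb_le : ∀ z : ℂ, ‖z‖ ≤ 1 → ‖b z‖ ≤ 1)
    (ha_form : ∃ P Q : Polynomial ℂ, (∀ z : ℂ, ‖z‖ ≤ 1 → P.eval z ≠ 0 ∧ Q.eval z ≠ 0) ∧
      ∀ z : ℂ, ‖z‖ ≤ 1 → a z = (∏ j, (z - ζ j) ^ m j) * P.eval z / Q.eval z)
    (hab : ∀ z : ℂ, ‖z‖ = 1 → ‖a z‖ ^ 2 + ‖b z‖ ^ 2 = 1) :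
    ∃ c C : ℝ, 0 < c ∧ 0 < C ∧ ∀ z : ℂ, ‖z‖ < 1 →
      c * (‖(zeroPoly ζ m).eval z‖ ^ 2 + (1 - ‖z‖ ^ 2)) ≤ 1 - ‖b z‖ ^ 2 ∧
      1 - ‖b z‖ ^ 2 ≤ C * (‖(zeroPoly ζ m).eval z‖ ^ 2 + (1 - ‖z‖ ^ 2)) := by
  obtain ⟨P, Q, hQ, hbPQ⟩ := hb_rat
  obtain ⟨R, S, hRS, haRS⟩ := ha_form
  have haRS' : ∀ z : ℂ, ‖z‖ ≤ 1 → a z = (zeroPoly ζ m * R).eval z / S.eval z := fun z hz => by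
    rw [haRS z hz, Polynomial.eval_mul, eval_zeroPoly]
  obtain ⟨L, hL, hLb⟩ := exists_norm_eval_div_sub_le (P := P) hQ
  obtain ⟨L', hL', hLa⟩ := exists_norm_eval_div_sub_le (P := zeroPoly ζ m * R)
    (fun z hz => (hRS z hz).2)
  obtain ⟨d, D, hd, hD, hdD⟩ := exists_le_norm_eval_div (fun z hz => (hRS z hz).1)
    (fun z hz => (hRS z hz).2)
  have haA : ∀ z : ℂ, ‖z‖ ≤ 1 → ‖a z‖ = ‖(zeroPoly ζ m).eval z‖ * ‖R.eval z / S.eval z‖ := by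
    intro z hz
    rw [haRS' z hz, Polynomial.eval_mul, mul_div_assoc, norm_mul]
  have hclos : ∀ {z : ℂ}, z ∈ closure (ball (0 : ℂ) 1) → ‖z‖ ≤ 1 := fun hz =>
    mem_closedBall_zero_iff.1 (closure_ball_subset_closedBall hz)
  have hbd : DiffContOnCl ℂ b (ball (0 : ℂ) 1) := by
    have h := diffContOnCl_eval_div (P := P) hQ
    exact ⟨h.1.congr fun z hz => hbPQ z (mem_ball_zero_iff.1 hz).le,
      h.2.congr fun z hz => hbPQ z (hclos hz)⟩
  have had : DiffContOnCl ℂ a (ball (0 : ℂ) 1) := by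
    have h := diffContOnCl_eval_div (P := zeroPoly ζ m * R) (fun z hz => (hRS z hz).2)
    exact ⟨h.1.congr fun z hz => haRS' z (mem_ball_zero_iff.1 hz).le,
      h.2.congr fun z hz => haRS' z (hclos hz)⟩
  have hpyth : ∀ z : ℂ, ‖z‖ < 1 → ‖a z‖ ^ 2 + ‖b z‖ ^ 2 ≤ 1 := fun z hz =>
    norm_sq_add_norm_sq_le_one had hbd hab hz
  have hb0 : ‖b 0‖ < 1 := by
    have h1 := hpyth 0 (by simp)
    have h2 : 0 < ‖a 0‖ := by
      rw [haA 0 (by simp)]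
      exact mul_pos (norm_pos_iff.2 (eval_zeroPoly_ne_zero hζ (by simp)))
        (hd.trans_le (hdD 0 (by simp)).1)
    nlinarith [norm_nonneg (b 0)]
  have hb0' : 0 < 1 - ‖b 0‖ := by linarith
  refine ⟨min (d ^ 2) ((1 - ‖b 0‖) ^ 2) / 2, 2 * D ^ 2 + (2 * L + 2 * L' ^ 2), by positivity,
    by positivity, fun z hz => ⟨?_, ?_⟩⟩
  · have h1 := hpyth z hz
    have h2 := one_sub_norm_sq_le_of_norm_le_one hbd.1 (fun w hw => hb_le w hw.le) hb0 hz
    have h3 : d ^ 2 * ‖(zeroPoly ζ m).eval z‖ ^ 2 ≤ ‖a z‖ ^ 2 := by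
      rw [haA z hz.le, mul_pow, mul_comm]
      have := (hdD z hz.le).1
      gcongr
    have h4 := min_le_left (d ^ 2) ((1 - ‖b 0‖) ^ 2)
    have h5 := min_le_right (d ^ 2) ((1 - ‖b 0‖) ^ 2)
    have h6 := one_sub_norm_sq_pos hz
    nlinarith [mul_le_mul_of_nonneg_right h4 (sq_nonneg ‖(zeroPoly ζ m).eval z‖),
      mul_le_mul_of_nonneg_right h5 h6.le]
  · obtain ⟨ω, hω, hzω⟩ := exists_norm_eq_one_norm_sub_eq hz.le
    have h1 := hLb ω z hω.le hz.le
    have h2 := hLa ω z hω.le hz.le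
    rw [← hbPQ ω hω.le, ← hbPQ z hz.le, norm_sub_rev ω, hzω] at h1
    rw [← haRS' ω hω.le, ← haRS' z hz.le, norm_sub_rev ω, hzω] at h2
    have h3 : ‖b ω‖ - ‖b z‖ ≤ L * (1 - ‖z‖) := (norm_sub_norm_le _ _).trans h1
    have h4 : ‖a ω‖ - ‖a z‖ ≤ L' * (1 - ‖z‖) := (norm_sub_norm_le _ _).trans h2
    have h5 := hab ω hω
    have h6 : ‖a z‖ ^ 2 ≤ D ^ 2 * ‖(zeroPoly ζ m).eval z‖ ^ 2 := by
      rw [haA z hz.le, mul_pow, mul_comm]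
      have := (hdD z hz.le).2
      gcongr
    have h7 : ‖b ω‖ ^ 2 - ‖b z‖ ^ 2 ≤ 2 * (L * (1 - ‖z‖)) := by
      have e1 := hb_le ω hω.le
      have e2 := hb_le z hz.le
      have e3 : 0 ≤ L * (1 - ‖z‖) := mul_nonneg hL (by linarith)
      nlinarith [norm_nonneg (b ω), norm_nonneg (b z)]
    have h8 : ‖a ω‖ ^ 2 ≤ 2 * ‖a z‖ ^ 2 + 2 * (L' * (1 - ‖z‖)) ^ 2 := by
      have : ‖a ω‖ ^ 2 ≤ (‖a z‖ + L' * (1 - ‖z‖)) ^ 2 :=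
        pow_le_pow_left₀ (norm_nonneg _) (by linarith) 2
      nlinarith [sq_nonneg (‖a z‖ - L' * (1 - ‖z‖))]
    have hn := norm_nonneg z
    have h9 : 1 - ‖z‖ ≤ 1 - ‖z‖ ^ 2 := by nlinarith
    have h10 : (1 - ‖z‖) ^ 2 ≤ 1 - ‖z‖ ^ 2 := by nlinarith
    have h11 : (L' * (1 - ‖z‖)) ^ 2 ≤ L' ^ 2 * (1 - ‖z‖ ^ 2) := by
      rw [mul_pow]; gcongr
    have h12 : L * (1 - ‖z‖) ≤ L * (1 - ‖z‖ ^ 2) := by gcongr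
    have h13 := one_sub_norm_sq_pos hz
    have h14 : 0 ≤ D ^ 2 * (1 - ‖z‖ ^ 2) := by positivity
    have h15 : 0 ≤ (2 * L + 2 * L' ^ 2) * ‖(zeroPoly ζ m).eval z‖ ^ 2 := by positivity
    nlinarith

/-- The polynomial with coefficient vector `u`. -/
def polyOf {N : ℕ} (u : Fin N → ℂ) : Polynomial ℂ :=
  ∑ k, Polynomial.C (u k) * Polynomial.X ^ (k : ℕ)

lemma exists_polyOf_eq {N : ℕ} {p : Polynomial ℂ} (hp : p.degree < (N : ℕ)) :
    ∃ u : Fin N → ℂ, polyOf u = p := by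
  obtain rfl | h0 := eq_or_ne p 0
  · exact ⟨0, by simp [polyOf]⟩
  · refine ⟨fun k => p.coeff k, ?_⟩
    rw [polyOf, Fin.sum_univ_eq_sum_range (fun k => Polynomial.C (p.coeff k) * Polynomial.X ^ k)]
    exact (p.as_sum_range_C_mul_X_pow' ((Polynomial.natDegree_lt_iff_degree_lt h0).2 hp)).symm

lemma eval_polyOf {N : ℕ} (u : Fin N → ℂ) (z : ℂ) :
    (polyOf u).eval z = ∑ k, u k * z ^ (k : ℕ) := by
  simp [polyOf, Polynomial.eval_finsetSum]

lemma norm_eval_polyOf_le {N : ℕ} (u : Fin N → ℂ) {z : ℂ} (hz : ‖z‖ ≤ 1) :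
    ‖(polyOf u).eval z‖ ≤ N * ‖u‖ := by
  rw [eval_polyOf]
  refine (norm_sum_le _ _).trans ?_
  calc ∑ k : Fin N, ‖u k * z ^ (k : ℕ)‖ ≤ ∑ _k : Fin N, ‖u‖ := by
        refine Finset.sum_le_sum fun k _ => ?_
        rw [norm_mul, norm_pow]
        exact (mul_le_of_le_one_right (norm_nonneg _) (pow_le_one₀ (norm_nonneg _) hz)).trans
          (norm_le_pi_norm u k)
    _ = _ := by simp

/-- The evaluation at `z` of the function `P g + p`, where `g` is in `H²` and `p` is a polynomial
of degree less than `N`. -/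
def evHb (P : Polynomial ℂ) (N : ℕ) (z : ℂ) : SqSeq × (Fin N → ℂ) →L[ℂ] ℂ :=
  P.eval z • (ev z).comp (ContinuousLinearMap.fst ℂ _ _) +
    (∑ k : Fin N, z ^ (k : ℕ) • ContinuousLinearMap.proj k).comp (ContinuousLinearMap.snd ℂ _ _)

lemma evHb_apply (P : Polynomial ℂ) (N : ℕ) (z : ℂ) (x : SqSeq × (Fin N → ℂ)) :
    evHb P N z x = P.eval z * ev z x.1 + (polyOf x.2).eval z := by
  simp [evHb, eval_polyOf, mul_comm]

section

variable {l : ℕ} {ζ : Fin l → ℂ} {m : Fin l → ℕ}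

lemma memHb_iff {f : ℂ → ℂ} : MemHb ζ m f ↔ ∃ x : SqSeq × (Fin (∑ j, m j) → ℂ),
    ∀ z : ℂ, ‖z‖ < 1 → f z = evHb (zeroPoly ζ m) (∑ j, m j) z x := by
  constructor
  · rintro ⟨g, p, hg, hp, hf⟩
    obtain ⟨c, hc⟩ := memHardy2_iff.1 hg
    obtain ⟨u, rfl⟩ := exists_polyOf_eq hp
    refine ⟨(c, u), fun z hz => ?_⟩
    rw [evHb_apply, hf z (mem_ball_zero_iff.2 hz), hc z hz, eval_zeroPoly]
  · rintro ⟨x, hx⟩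
    refine ⟨fun z => ev z x.1, polyOf x.2, memHardy2_ev _, Polynomial.degree_sum_fin_lt _,
      fun z hz => ?_⟩
    rw [hx z (mem_ball_zero_iff.1 hz), evHb_apply, eval_zeroPoly]

lemma memHb_of_eq_mul_ev {f : ℂ → ℂ} (c : SqSeq)
    (hf : ∀ z : ℂ, ‖z‖ < 1 → f z = (zeroPoly ζ m).eval z * ev z c) : MemHb ζ m f :=
  memHb_iff.2 ⟨(c, 0), fun z hz => by simp [evHb_apply, hf z hz, polyOf]⟩

lemma norm_sub_pos (hζ : ∀ j, ‖ζ j‖ = 1) {z : ℂ} (hz : ‖z‖ < 1) (j : Fin l) : 0 < ‖ζ j - z‖ :=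
  norm_pos_iff.2 (sub_ne_zero.2 fun h => by rw [← h, hζ j] at hz; exact lt_irrefl _ hz)

/-- Functions peaking at `w` relative to the zeros of `zeroPoly ζ m`. -/
lemma exists_peak (hζ : ∀ j, ‖ζ j‖ = 1) (m : Fin l → ℕ) {w : ℂ} (hw : ‖w‖ < 1) :
    ∃ h : ℂ → ℂ, DifferentiableOn ℂ h (ball (0 : ℂ) 1) ∧ h w = 1 ∧
      (∀ z : ℂ, ‖z‖ < 1 → ‖h z‖ ≤ ∏ j, 2 ^ m j) ∧
      ∀ z : ℂ, ‖z‖ < 1 → ‖(zeroPoly ζ m).eval z * h z‖ ≤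
        (∏ j, 4 ^ m j) * ‖(zeroPoly ζ m).eval w‖ := by
  set τ : Fin l → ℂ := fun j => ((1 + ‖ζ j - w‖ : ℝ) : ℂ) * ζ j with hτ
  have hpos : ∀ j, 0 < ‖ζ j - w‖ := norm_sub_pos hζ hw
  have hτζ : ∀ j, ‖τ j - ζ j‖ = ‖ζ j - w‖ := by
    intro j
    have : τ j - ζ j = ((‖ζ j - w‖ : ℝ) : ℂ) * ζ j := by simp only [hτ]; push_cast; ring
    rw [this, norm_mul, hζ j, mul_one, Complex.norm_real, norm_norm]
  have hτz : ∀ j, ∀ z : ℂ, ‖z‖ < 1 → ‖ζ j - w‖ ≤ ‖z - τ j‖ := by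
    intro j z hz
    have h1 := norm_sub_norm_le (τ j) z
    have h2 : ‖τ j‖ = 1 + ‖ζ j - w‖ := by
      rw [hτ, norm_mul, hζ j, mul_one, Complex.norm_real, Real.norm_of_nonneg (by positivity)]
    rw [norm_sub_rev z]
    linarith
  have hτw : ∀ j, ‖w - τ j‖ ≤ 2 * ‖ζ j - w‖ := by
    intro j
    have h1 := norm_add_le (w - ζ j) (ζ j - τ j)
    rw [sub_add_sub_cancel, norm_sub_rev w (ζ j), norm_sub_rev (ζ j) (τ j), hτζ] at h1
    linarith
  have hτ0 : ∀ j, ∀ z : ℂ, ‖z‖ < 1 → 0 < ‖z - τ j‖ := fun j z hz => (hpos j).trans_le (hτz j z hz)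
  refine ⟨fun z => ∏ j, ((w - τ j) / (z - τ j)) ^ m j, ?_, ?_, fun z hz => ?_, fun z hz => ?_⟩
  · refine DifferentiableOn.fun_finsetProd fun j _ => DifferentiableOn.fun_pow
      (DifferentiableOn.div (by fun_prop) (by fun_prop) fun z hz => ?_) _
    exact norm_pos_iff.1 (hτ0 j z (mem_ball_zero_iff.1 hz))
  · refine Finset.prod_eq_one fun j _ => ?_
    rw [div_self (norm_pos_iff.1 (hτ0 j w hw)), one_pow]
  · rw [norm_prod]
    refine Finset.prod_le_prod (fun _ _ => norm_nonneg _) fun j _ => ?_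
    rw [norm_pow, norm_div]
    refine pow_le_pow_left₀ (by positivity) ?_ _
    rw [div_le_iff₀ (hτ0 j z hz)]
    linarith [hτw j, hτz j z hz]
  · rw [eval_zeroPoly, eval_zeroPoly, ← Finset.prod_mul_distrib, norm_prod, norm_prod,
      ← Finset.prod_mul_distrib]
    refine Finset.prod_le_prod (fun _ _ => norm_nonneg _) fun j _ => ?_
    rw [← mul_pow, norm_pow, norm_pow, ← mul_pow, norm_mul, norm_div]
    refine pow_le_pow_left₀ (by positivity) ?_ _
    rw [← mul_div_assoc, div_le_iff₀ (hτ0 j z hz), norm_sub_rev w (ζ j)]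
    have h1 : ‖z - ζ j‖ ≤ 2 * ‖z - τ j‖ := by
      have h2 := norm_add_le (z - τ j) (τ j - ζ j)
      rw [sub_add_sub_cancel, hτζ] at h2
      linarith [hτz j z hz]
    have h3 := mul_le_mul h1 (hτw j) (norm_nonneg _) (by positivity)
    linarith

/-- Sufficiency of the geometric condition for multiplier interpolation. -/
lemma multInterp_of_carlesonCond (hζ : ∀ j, ‖ζ j‖ = 1) {Λ : ℕ → ℂ} (hΛ : ∀ n, ‖Λ n‖ < 1)
    (hC : CarlesonCond Λ)
    (ht : Summable fun n => (1 - ‖Λ n‖ ^ 2) / ‖(zeroPoly ζ m).eval (Λ n)‖ ^ 2) :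
    MultInterp ζ m Λ := by
  rintro v ⟨V, hV⟩
  have hV0 : 0 ≤ V := (norm_nonneg _).trans (hV 0)
  obtain ⟨M, -, hM⟩ := exists_interpolation hΛ hC
  have hA : ∀ n, (zeroPoly ζ m).eval (Λ n) ≠ 0 := fun n => eval_zeroPoly_ne_zero hζ (hΛ n)
  have hL : ∀ n, 0 ≤ 1 - ‖Λ n‖ ^ 2 := fun n => (one_sub_norm_sq_pos (hΛ n)).le
  choose h hd h1 h2 h4 using fun n => exists_peak hζ m (hΛ n)
  obtain ⟨d, hdΛ, hdb⟩ := hM (fun n => v n / (zeroPoly ζ m).eval (Λ n)) h _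
    (Summable.of_nonneg_of_le (fun n => mul_nonneg (by positivity) (hL n)) (fun n => by
      rw [norm_div, div_pow, div_mul_eq_mul_div, mul_div_assoc]
      exact mul_le_mul_of_nonneg_right (pow_le_pow_left₀ (norm_nonneg _) (hV n) 2)
        (div_nonneg (hL n) (by positivity))) (ht.mul_left (V ^ 2))) hd h2 h1
  have hb := hdb (fun z => (zeroPoly ζ m).eval z) (V * ∏ j, 4 ^ m j) (fun n z hz => by
    rw [mul_left_comm, norm_mul, norm_div, div_mul_eq_mul_div,
      div_le_iff₀ (norm_pos_iff.2 (hA n)), mul_assoc]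
    exact mul_le_mul (hV n) (h4 n z hz) (norm_nonneg _) hV0)
  refine ⟨fun z => (zeroPoly ζ m).eval z * ev z d, fun f hf => ?_, fun n => ?_⟩
  · obtain ⟨x, hx⟩ := memHb_iff.1 hf
    obtain ⟨c', hc'⟩ := exists_ev_mul (φ := fun z => (zeroPoly ζ m).eval z * ev z d)
      (DifferentiableOn.mul (by fun_prop) (differentiableOn_ev d)) hb x.1
    obtain ⟨d', hd'⟩ := exists_ev_eval_mul (polyOf x.2) d
    refine memHb_of_eq_mul_ev (c' + d') fun z hz => ?_
    rw [hx z hz, map_add, hc' z hz, hd' z hz, evHb_apply]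
    ring
  · simp only [hdΛ n]
    exact mul_div_cancel₀ _ (hA n)

lemma norm_eval_sq_le_h2NormSq {N : ℕ} {p : Polynomial ℂ} (hp : p.degree < (N : ℕ)) {z : ℂ}
    (hz : ‖z‖ ≤ 1) : ‖p.eval z‖ ^ 2 ≤ N * h2NormSq fun z => p.eval z := by
  obtain ⟨c, hc, hcp⟩ := exists_ev_eval p
  rw [h2NormSq_eq hcp]
  have h1 : ‖p.eval z‖ ≤ ∑ k ∈ Finset.range N, ‖c k‖ := by
    obtain rfl | h0 := eq_or_ne p 0
    · rw [Polynomial.eval_zero, norm_zero]; positivity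
    rw [Polynomial.eval_eq_sum_range' ((Polynomial.natDegree_lt_iff_degree_lt h0).2 hp)]
    refine (norm_sum_le _ _).trans (Finset.sum_le_sum fun k _ => ?_)
    rw [norm_mul, norm_pow, hc]
    exact mul_le_of_le_one_right (norm_nonneg _) (pow_le_one₀ (norm_nonneg _) hz)
  refine (pow_le_pow_left₀ (norm_nonneg _) h1 2).trans ?_
  have h2 := sq_sum_le_card_mul_sum_sq (s := Finset.range N) (f := fun k => ‖c k‖)
  rw [Finset.card_range] at h2
  refine h2.trans (mul_le_mul_of_nonneg_left ?_ (by positivity))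
  rw [norm_sq_eq_tsum]
  exact (summable_sq_norm c).sum_le_tsum _ fun _ _ => by positivity

/-- Sufficiency of the geometric condition for universal interpolation. -/
lemma univInterp_of_carlesonCond {b : ℂ → ℂ} (hζ : ∀ j, ‖ζ j‖ = 1) {κ K : ℝ} (hκ : 0 < κ)
    (hb : ∀ z : ℂ, ‖z‖ < 1 →
      κ * (‖(zeroPoly ζ m).eval z‖ ^ 2 + (1 - ‖z‖ ^ 2)) ≤ 1 - ‖b z‖ ^ 2 ∧
      1 - ‖b z‖ ^ 2 ≤ K * (‖(zeroPoly ζ m).eval z‖ ^ 2 + (1 - ‖z‖ ^ 2)))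
    {Λ : ℕ → ℂ} (hΛ : ∀ n, ‖Λ n‖ < 1) (hC : CarlesonCond Λ)
    (ht : Summable fun n => (1 - ‖Λ n‖ ^ 2) / ‖(zeroPoly ζ m).eval (Λ n)‖ ^ 2) :
    UnivInterp ζ m b Λ := by
  have hA : ∀ n, 0 < ‖(zeroPoly ζ m).eval (Λ n)‖ := fun n =>
    norm_pos_iff.2 (eval_zeroPoly_ne_zero hζ (hΛ n))
  have hL : ∀ n, 0 < 1 - ‖Λ n‖ ^ 2 := fun n => one_sub_norm_sq_pos (hΛ n)
  have hB : ∀ n, 0 < 1 - ‖b (Λ n)‖ ^ 2 := fun n =>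
    lt_of_lt_of_le (mul_pos hκ (by have := hL n; positivity)) (hb _ (hΛ n)).1
  have hw : ∀ n, (1 - ‖Λ n‖ ^ 2) / (1 - ‖b (Λ n)‖ ^ 2) ≤
      κ⁻¹ * ((1 - ‖Λ n‖ ^ 2) / ‖(zeroPoly ζ m).eval (Λ n)‖ ^ 2) := by
    intro n
    have h1 := (hb _ (hΛ n)).1
    have h2 := hA n
    have h3 : κ * ‖(zeroPoly ζ m).eval (Λ n)‖ ^ 2 ≤ 1 - ‖b (Λ n)‖ ^ 2 := by
      nlinarith [mul_pos hκ (hL n)]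
    rw [inv_mul_eq_div, div_div, mul_comm _ κ]
    exact div_le_div_of_nonneg_left (hL n).le (by positivity) h3
  constructor
  · obtain ⟨M, hM⟩ := exists_sum_norm_ev_sq_le hΛ hC
    set T := ∑' n, (1 - ‖Λ n‖ ^ 2) / ‖(zeroPoly ζ m).eval (Λ n)‖ ^ 2 with hT
    have hT0 : 0 ≤ T := tsum_nonneg fun n => div_nonneg (hL n).le (by positivity)
    refine ⟨2 * κ⁻¹ * |M| + 2 * κ⁻¹ * ((∑ j, m j : ℕ) * T), fun g p hg hp F => ?_⟩
    obtain ⟨c, hc⟩ := memHardy2_iff.1 hg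
    have hg2 := h2NormSq_eq hc
    have hpn : 0 ≤ h2NormSq fun z => p.eval z := by
      obtain ⟨c, -, hcp⟩ := exists_ev_eval p
      rw [h2NormSq_eq hcp]; positivity
    have hterm : ∀ n, ‖(∏ j, (Λ n - ζ j) ^ m j) * g (Λ n) + p.eval (Λ n)‖ ^ 2 *
        ((1 - ‖Λ n‖ ^ 2) / (1 - ‖b (Λ n)‖ ^ 2)) ≤
        2 * κ⁻¹ * (‖ev (Λ n) c‖ ^ 2 * (1 - ‖Λ n‖ ^ 2)) +
          2 * κ⁻¹ * ((∑ j, m j : ℕ) * h2NormSq fun z => p.eval z) *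
            ((1 - ‖Λ n‖ ^ 2) / ‖(zeroPoly ζ m).eval (Λ n)‖ ^ 2) := by
      intro n
      rw [← eval_zeroPoly, hc _ (hΛ n)]
      have h1 : ‖(zeroPoly ζ m).eval (Λ n) * ev (Λ n) c + p.eval (Λ n)‖ ^ 2 ≤
          2 * (‖(zeroPoly ζ m).eval (Λ n)‖ ^ 2 * ‖ev (Λ n) c‖ ^ 2) + 2 * ‖p.eval (Λ n)‖ ^ 2 := by
        have h2 := pow_le_pow_left₀ (norm_nonneg _)
          (norm_add_le ((zeroPoly ζ m).eval (Λ n) * ev (Λ n) c) (p.eval (Λ n))) 2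
        refine h2.trans ?_
        rw [norm_mul, ← mul_pow]
        nlinarith [sq_nonneg (‖(zeroPoly ζ m).eval (Λ n)‖ * ‖ev (Λ n) c‖ - ‖p.eval (Λ n)‖)]
      have h3 := norm_eval_sq_le_h2NormSq hp (hΛ n).le
      have h4 : 0 ≤ (1 - ‖Λ n‖ ^ 2) / ‖(zeroPoly ζ m).eval (Λ n)‖ ^ 2 :=
        div_nonneg (hL n).le (by positivity)
      calc _ ≤ (2 * (‖(zeroPoly ζ m).eval (Λ n)‖ ^ 2 * ‖ev (Λ n) c‖ ^ 2) +
              2 * ((∑ j, m j : ℕ) * h2NormSq fun z => p.eval z)) *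
            (κ⁻¹ * ((1 - ‖Λ n‖ ^ 2) / ‖(zeroPoly ζ m).eval (Λ n)‖ ^ 2)) := by
            refine mul_le_mul (h1.trans ?_) (hw n) (div_nonneg (hL n).le (hB n).le)
              (by positivity)
            gcongr
        _ = _ := by
            have := (hA n).ne'
            field_simp
    refine (Finset.sum_le_sum fun n _ => hterm n).trans ?_
    rw [Finset.sum_add_distrib, ← Finset.mul_sum, ← Finset.mul_sum, hg2]
    have h5 : ∑ n ∈ F, ‖ev (Λ n) c‖ ^ 2 * (1 - ‖Λ n‖ ^ 2) ≤ |M| * ‖c‖ ^ 2 :=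
      (hM c F).trans (mul_le_mul_of_nonneg_right (le_abs_self M) (by positivity))
    have h6 : ∑ n ∈ F, (1 - ‖Λ n‖ ^ 2) / ‖(zeroPoly ζ m).eval (Λ n)‖ ^ 2 ≤ T :=
      ht.sum_le_tsum _ fun n _ => div_nonneg (hL n).le (by positivity)
    have h7 : 0 ≤ 2 * κ⁻¹ * |M| * h2NormSq fun z => p.eval z := by positivity
    have h8 : 0 ≤ 2 * κ⁻¹ * ((∑ j, m j : ℕ) * T) * ‖c‖ ^ 2 := by positivity
    have h9 := mul_le_mul_of_nonneg_left h5 (show 0 ≤ 2 * κ⁻¹ by positivity)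
    have h10 := mul_le_mul_of_nonneg_left h6
      (show 0 ≤ 2 * κ⁻¹ * ((∑ j, m j : ℕ) * h2NormSq fun z => p.eval z) by positivity)
    nlinarith
  · intro w hws
    obtain ⟨M, -, hM⟩ := exists_interpolation hΛ hC
    set T := ∑' n, (1 - ‖Λ n‖ ^ 2) / ‖(zeroPoly ζ m).eval (Λ n)‖ ^ 2 with hT
    have hs : ∀ n, 0 < √((1 - ‖Λ n‖ ^ 2) / (1 - ‖b (Λ n)‖ ^ 2)) := fun n =>
      Real.sqrt_pos.2 (div_pos (hL n) (hB n))
    obtain ⟨d, hd, -⟩ := hM (fun n => w n / ((zeroPoly ζ m).eval (Λ n) *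
      (√((1 - ‖Λ n‖ ^ 2) / (1 - ‖b (Λ n)‖ ^ 2)) : ℂ))) (fun _ _ => 1) 1
      (Summable.of_nonneg_of_le (fun n => mul_nonneg (by positivity) (hL n).le) (fun n => by
        have h1 := hA n
        have h2 := hL n
        have h3 := hB n
        have h4 := (hb _ (hΛ n)).2
        have h5 : (1 - ‖Λ n‖ ^ 2) / ‖(zeroPoly ζ m).eval (Λ n)‖ ^ 2 ≤ T :=
          ht.le_tsum n fun k _ => div_nonneg (hL k).le (by positivity)
        have hK : 0 ≤ K := by
          by_contra! hK
          have := mul_neg_of_neg_of_pos hK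
            (show 0 < ‖(zeroPoly ζ m).eval (Λ n)‖ ^ 2 + (1 - ‖Λ n‖ ^ 2) by positivity)
          linarith
        have h6 : (1 - ‖b (Λ n)‖ ^ 2) / ‖(zeroPoly ζ m).eval (Λ n)‖ ^ 2 ≤ K * (1 + T) := by
          rw [div_le_iff₀ (by positivity)] at h5 ⊢
          refine h4.trans ?_
          rw [mul_assoc]
          refine mul_le_mul_of_nonneg_left ?_ hK
          linarith
        rw [norm_div, norm_mul, Complex.norm_real, Real.norm_of_nonneg (hs n).le, div_pow, mul_pow,
          Real.sq_sqrt (by positivity)]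
        calc _ = (1 - ‖b (Λ n)‖ ^ 2) / ‖(zeroPoly ζ m).eval (Λ n)‖ ^ 2 * ‖w n‖ ^ 2 := by
              field_simp
          _ ≤ K * (1 + T) * ‖w n‖ ^ 2 := mul_le_mul_of_nonneg_right h6 (by positivity))
        (hws.mul_left (K * (1 + T))))
      (fun _ => differentiableOn_const _) (fun _ _ _ => by simp) (fun _ => rfl)
    refine ⟨fun z => (zeroPoly ζ m).eval z * ev z d, memHb_of_eq_mul_ev d fun _ _ => rfl,
      fun n => ?_⟩
    simp only [hd n]
    have h1 : (√((1 - ‖Λ n‖ ^ 2) / (1 - ‖b (Λ n)‖ ^ 2)) : ℂ) ≠ 0 := by exact_mod_cast (hs n).ne'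
    have h2 := norm_pos_iff.1 (hA n)
    field_simp

end

section

variable {l : ℕ} {ζ : Fin l → ℂ} {m : Fin l → ℕ}

lemma ev_add_eval_mem_ideal (P : Polynomial ℂ) (Λ : ℕ → ℂ) (hΛ : ∀ n, ‖Λ n‖ < 1) :
    ∃ I : Ideal (Polynomial ℂ), ∀ q : Polynomial ℂ,
      q ∈ I ↔ ∃ d : SqSeq, ∀ n, P.eval (Λ n) * ev (Λ n) d + q.eval (Λ n) = 0 := by
  refine ⟨
    { carrier := {q | ∃ d : SqSeq, ∀ n, P.eval (Λ n) * ev (Λ n) d + q.eval (Λ n) = 0}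
      add_mem' := ?_
      zero_mem' := ⟨0, fun n => by simp⟩
      smul_mem' := ?_ }, fun q => Iff.rfl⟩
  · rintro q r ⟨d, hd⟩ ⟨e, he⟩
    refine ⟨d + e, fun n => ?_⟩
    rw [map_add, Polynomial.eval_add, mul_add]
    linear_combination hd n + he n
  · rintro r q ⟨d, hd⟩
    obtain ⟨e, he⟩ := exists_ev_eval_mul r d
    refine ⟨e, fun n => ?_⟩
    rw [he _ (hΛ n), smul_eq_mul, Polynomial.eval_mul]
    linear_combination r.eval (Λ n) * hd n

lemma exists_ev_eq_neg_one (hζ : ∀ j, ‖ζ j‖ = 1) (hm : ∀ j, 1 ≤ m j) {Λ : ℕ → ℂ}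
    (hΛ : ∀ n, ‖Λ n‖ < 1) {ρ : ℕ → ℝ} (hρ : ∀ n, 0 < ρ n) (hρs : Summable ρ)
    (h : ∀ w : ℕ → ℂ, (Summable fun n => ‖w n‖ ^ 2) → ∃ f : ℂ → ℂ, MemHb ζ m f ∧
      ∀ n, f (Λ n) * (√(ρ n) : ℂ) = w n) :
    ∃ d : SqSeq, ∀ n, (zeroPoly ζ m).eval (Λ n) * ev (Λ n) d + 1 = 0 := by
  obtain ⟨I, hI⟩ := ev_add_eval_mem_ideal (zeroPoly ζ m) Λ hΛ
  suffices h1 : (1 : Polynomial ℂ) ∈ I by simpa using (hI 1).1 h1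
  by_contra h1
  have hAI : zeroPoly ζ m ∈ I := by
    obtain ⟨c, -, hc⟩ := exists_ev_eval (-1)
    refine (hI _).2 ⟨c, fun n => ?_⟩
    rw [← hc _ (hΛ n)]
    simp
  obtain ⟨j, hj⟩ : ∃ j, ∀ q ∈ I, q.eval (ζ j) = 0 := by
    set g := Submodule.IsPrincipal.generator I with hg
    have hgI : ∀ q, q ∈ I ↔ g ∣ q := fun q => Submodule.IsPrincipal.mem_iff_generator_dvd I
    have hdeg : g.degree ≠ 0 := fun h0 =>
      h1 ((hgI 1).2 (Polynomial.isUnit_iff_degree_eq_zero.2 h0).dvd)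
    obtain ⟨z, hz⟩ := IsAlgClosed.exists_root g hdeg
    obtain ⟨j, rfl⟩ := (eval_zeroPoly_eq_zero_iff hm).1
      (Polynomial.eval_eq_zero_of_dvd_of_eval_eq_zero ((hgI _).1 hAI) hz)
    exact ⟨j, fun q hq => Polynomial.eval_eq_zero_of_dvd_of_eval_eq_zero ((hgI q).1 hq) hz⟩
  obtain ⟨C, hC, hsol⟩ := exists_norm_le_of_solvable
    (fun n => (√(ρ n) : ℂ) • evHb (zeroPoly ζ m) (∑ j, m j) (Λ n))
    (fun n => lp.evalCLM ℂ (fun _ : ℕ => ℂ) 2 n) (fun y => by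
      obtain ⟨f, hf, hfy⟩ := h (fun n => y n) (summable_sq_norm y)
      obtain ⟨x, hx⟩ := memHb_iff.1 hf
      refine ⟨x, fun n => ?_⟩
      rw [_root_.smul_apply, smul_eq_mul, ← hx _ (hΛ n), mul_comm]
      exact hfy n)
  set N : ℝ := ((∑ j, m j : ℕ) : ℝ) with hN
  have hε : 0 < (1 / (N * C + 1)) ^ 2 := by positivity
  obtain ⟨k, hk⟩ := ((tendsto_sum_nat_add ρ).eventually (gt_mem_nhds hε)).exists
  have hnorm : ∀ n, ‖(if n < k then 0 else (√(ρ n) : ℂ))‖ ^ 2 = if n < k then 0 else ρ n := by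
    intro n
    split_ifs
    · simp
    · rw [Complex.norm_real, Real.norm_of_nonneg (Real.sqrt_nonneg _), Real.sq_sqrt (hρ n).le]
  have hs : Summable fun n => if n < k then 0 else ρ n :=
    Summable.of_nonneg_of_le (fun n => by split_ifs <;> simp [(hρ n).le])
      (fun n => by split_ifs <;> simp [(hρ n).le]) hρs
  obtain ⟨y, hy⟩ := exists_sqSeq (c := fun n => if n < k then 0 else (√(ρ n) : ℂ))
    (by simpa only [hnorm] using hs)
  have hyn : ‖y‖ < 1 / (N * C + 1) := by
    refine lt_of_pow_lt_pow_left₀ 2 (by positivity) ?_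
    rw [norm_sq_eq_tsum]
    simp only [hy, hnorm]
    rw [← hs.sum_add_tsum_nat_add k, Finset.sum_eq_zero fun n hn => if_pos (Finset.mem_range.1 hn),
      zero_add]
    simpa using hk
  obtain ⟨x, hx, hxn⟩ := hsol y
  have hx' : ∀ n, ¬ n < k →
      (zeroPoly ζ m).eval (Λ n) * ev (Λ n) x.1 + (polyOf x.2).eval (Λ n) = 1 := by
    intro n hn
    have h2 : (√(ρ n) : ℂ) * evHb (zeroPoly ζ m) (∑ j, m j) (Λ n) x = y n := hx n
    rw [hy, if_neg hn, evHb_apply] at h2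
    have h3 : (√(ρ n) : ℂ) ≠ 0 := by exact_mod_cast (Real.sqrt_pos.2 (hρ n)).ne'
    exact mul_left_cancel₀ h3 (by rw [h2, mul_one])
  set q : Polynomial ℂ := ∏ n ∈ Finset.range k, (Polynomial.X - Polynomial.C (Λ n)) with hq
  have hmem : q * (polyOf x.2 - 1) ∈ I := by
    obtain ⟨d, hd⟩ := exists_ev_eval_mul q x.1
    refine (hI _).2 ⟨d, fun n => ?_⟩
    rw [hd _ (hΛ n), Polynomial.eval_mul, Polynomial.eval_sub, Polynomial.eval_one]
    by_cases hn : n < k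
    · have : q.eval (Λ n) = 0 := by
        rw [hq, Polynomial.eval_prod]
        exact Finset.prod_eq_zero (Finset.mem_range.2 hn) (by simp)
      rw [this]
      ring
    · linear_combination q.eval (Λ n) * hx' n hn
  have h2 := hj _ hmem
  rw [Polynomial.eval_mul, Polynomial.eval_sub, Polynomial.eval_one, mul_eq_zero, or_iff_right,
    sub_eq_zero] at h2
  · have h3 := norm_eval_polyOf_le x.2 (hζ j).le
    rw [h2, norm_one, ← hN] at h3
    have h4 : ‖x.2‖ ≤ C * ‖y‖ := (norm_snd_le x).trans hxn
    have h5 : N * ‖x.2‖ ≤ N * C * (1 / (N * C + 1)) := by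
      rw [mul_assoc]
      exact mul_le_mul_of_nonneg_left (h4.trans (by gcongr)) (by positivity)
    have h6 : N * C * (1 / (N * C + 1)) < 1 := by
      rw [mul_one_div, div_lt_one (by positivity)]
      linarith
    linarith
  · rw [hq, Polynomial.eval_prod, Finset.prod_eq_zero_iff]
    rintro ⟨n, -, hn⟩
    have := norm_sub_pos hζ (hΛ n) j
    simp only [Polynomial.eval_sub, Polynomial.eval_X, Polynomial.eval_C] at hn
    rw [hn, norm_zero] at this
    exact lt_irrefl _ this

/-- Necessity of the geometric condition for universal interpolation. -/
lemma carlesonCond_of_univInterp {b : ℂ → ℂ} (hζ : ∀ j, ‖ζ j‖ = 1) (hm : ∀ j, 1 ≤ m j)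
    (hN : 0 < ∑ j, m j) {κ K : ℝ} (hκ : 0 < κ) (hK : 0 < K)
    (hb : ∀ z : ℂ, ‖z‖ < 1 →
      κ * (‖(zeroPoly ζ m).eval z‖ ^ 2 + (1 - ‖z‖ ^ 2)) ≤ 1 - ‖b z‖ ^ 2 ∧
      1 - ‖b z‖ ^ 2 ≤ K * (‖(zeroPoly ζ m).eval z‖ ^ 2 + (1 - ‖z‖ ^ 2)))
    {Λ : ℕ → ℂ} (hΛ : ∀ n, ‖Λ n‖ < 1) (hU : UnivInterp ζ m b Λ) :
    CarlesonCond Λ ∧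
      Summable fun n => (1 - ‖Λ n‖ ^ 2) / ‖(zeroPoly ζ m).eval (Λ n)‖ ^ 2 := by
  obtain ⟨⟨C, hC⟩, hsurj⟩ := hU
  have hA : ∀ n, 0 < ‖(zeroPoly ζ m).eval (Λ n)‖ := fun n =>
    norm_pos_iff.2 (eval_zeroPoly_ne_zero hζ (hΛ n))
  have hL : ∀ n, 0 < 1 - ‖Λ n‖ ^ 2 := fun n => one_sub_norm_sq_pos (hΛ n)
  have hB : ∀ n, 0 < 1 - ‖b (Λ n)‖ ^ 2 := fun n =>
    lt_of_lt_of_le (mul_pos hκ (by have := hL n; positivity)) (hb _ (hΛ n)).1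
  set ρ : ℕ → ℝ := fun n => (1 - ‖Λ n‖ ^ 2) / (1 - ‖b (Λ n)‖ ^ 2) with hρ
  have hρ0 : ∀ n, 0 < ρ n := fun n => div_pos (hL n) (hB n)
  have hρs : Summable ρ := by
    refine summable_of_sum_le
      (c := C * (h2NormSq (fun z => ev z 0) + h2NormSq fun z => (1 : Polynomial ℂ).eval z))
      (fun n => (hρ0 n).le) fun F => ?_
    have h1 := hC (fun z => ev z 0) 1 (memHardy2_ev 0) (by
      rw [Polynomial.degree_one]; exact_mod_cast hN) F
    refine le_trans (le_of_eq (Finset.sum_congr rfl fun n _ => ?_)) h1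
    simp [hρ]
  have ht : Summable fun n => (1 - ‖Λ n‖ ^ 2) / ‖(zeroPoly ζ m).eval (Λ n)‖ ^ 2 := by
    refine Summable.of_norm_bounded_eventually_nat (hρs.mul_left (2 * K)) ?_
    have h1 : ∀ᶠ n in atTop, ρ n < 1 / (2 * K) :=
      hρs.tendsto_atTop_zero.eventually (gt_mem_nhds (by positivity))
    filter_upwards [h1] with n hn
    have h2 := hA n
    have h3 := hL n
    have h4 := hB n
    have h5 := (hb _ (hΛ n)).2
    rw [Real.norm_of_nonneg (by positivity)]
    simp only [hρ] at hn ⊢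
    rw [div_lt_div_iff₀ h4 (by positivity)] at hn
    rw [← mul_div_assoc, div_le_div_iff₀ (by positivity) h4]
    have h6 : 1 - ‖Λ n‖ ^ 2 ≤ ‖(zeroPoly ζ m).eval (Λ n)‖ ^ 2 := by
      by_contra! h7
      nlinarith
    have h8 : 1 - ‖b (Λ n)‖ ^ 2 ≤ 2 * K * ‖(zeroPoly ζ m).eval (Λ n)‖ ^ 2 := by nlinarith
    nlinarith
  refine ⟨?_, ht⟩
  set T := ∑' n, (1 - ‖Λ n‖ ^ 2) / ‖(zeroPoly ζ m).eval (Λ n)‖ ^ 2 with hT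
  have hT0 : 0 ≤ T := tsum_nonneg fun n => div_nonneg (hL n).le (by positivity)
  have hLT : ∀ n, 1 - ‖Λ n‖ ^ 2 ≤ T * ‖(zeroPoly ζ m).eval (Λ n)‖ ^ 2 := by
    intro n
    have h5 : (1 - ‖Λ n‖ ^ 2) / ‖(zeroPoly ζ m).eval (Λ n)‖ ^ 2 ≤ T :=
      ht.le_tsum n fun k _ => div_nonneg (hL k).le (by positivity)
    rwa [div_le_iff₀ (pow_pos (hA n) 2)] at h5
  have hemb : ∀ c : SqSeq, Summable fun n => ‖ev (Λ n) c‖ ^ 2 * (1 - ‖Λ n‖ ^ 2) := by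
    intro c
    refine summable_of_sum_le (c := K * (1 + T) * (C * ‖c‖ ^ 2))
      (fun n => mul_nonneg (by positivity) (hL n).le) fun F => ?_
    have h1 := hC (fun z => ev z c) 0 (memHardy2_ev c) (by
      rw [Polynomial.degree_zero]; exact WithBot.bot_lt_coe _) F
    have h2 : h2NormSq (fun z => (0 : Polynomial ℂ).eval z) = 0 := by
      rw [h2NormSq_eq (c := 0) fun z _ => by simp]; simp
    rw [h2NormSq_eq (c := c) fun z _ => rfl, h2, add_zero] at h1
    refine le_trans ?_ (mul_le_mul_of_nonneg_left h1 (by positivity))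
    rw [Finset.mul_sum]
    refine Finset.sum_le_sum fun n _ => ?_
    rw [Polynomial.eval_zero, add_zero, ← eval_zeroPoly, norm_mul, mul_pow]
    have h3 : 1 - ‖b (Λ n)‖ ^ 2 ≤ K * (1 + T) * ‖(zeroPoly ζ m).eval (Λ n)‖ ^ 2 := by
      nlinarith [(hb _ (hΛ n)).2, hLT n]
    have h4 := hB n
    rw [← mul_div_assoc, ← mul_div_assoc, le_div_iff₀ h4]
    have h5 := mul_le_mul_of_nonneg_left h3
      (mul_nonneg (sq_nonneg ‖ev (Λ n) c‖) (hL n).le)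
    linarith
  obtain ⟨d₀, hd₀⟩ := exists_ev_eq_neg_one hζ hm hΛ hρ0 hρs hsurj
  refine carlesonCond_of_mul hΛ fun v ⟨V, hV⟩ c => ?_
  obtain ⟨f, hf, hfv⟩ := hsurj
    (fun n => (v n * ev (Λ n) c) * (zeroPoly ζ m).eval (Λ n) * (√(ρ n) : ℂ))
    (Summable.of_nonneg_of_le (fun n => by positivity) (fun n => by
      rw [norm_mul, norm_mul, norm_mul, Complex.norm_real,
        Real.norm_of_nonneg (Real.sqrt_nonneg _), mul_pow, mul_pow, mul_pow,
        Real.sq_sqrt (hρ0 n).le]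
      have h1 : ‖(zeroPoly ζ m).eval (Λ n)‖ ^ 2 * ρ n ≤ κ⁻¹ * (1 - ‖Λ n‖ ^ 2) := by
        simp only [hρ]
        rw [← mul_div_assoc, div_le_iff₀ (hB n)]
        have h2 : ‖(zeroPoly ζ m).eval (Λ n)‖ ^ 2 ≤ κ⁻¹ * (1 - ‖b (Λ n)‖ ^ 2) := by
          rw [inv_mul_eq_div, le_div_iff₀ hκ]
          nlinarith [(hb _ (hΛ n)).1, mul_pos hκ (hL n)]
        nlinarith [hL n]
      have h3 : ‖v n‖ ^ 2 ≤ V ^ 2 := pow_le_pow_left₀ (norm_nonneg _) (hV n) 2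
      calc ‖v n‖ ^ 2 * ‖ev (Λ n) c‖ ^ 2 * ‖(zeroPoly ζ m).eval (Λ n)‖ ^ 2 * ρ n
          = ‖v n‖ ^ 2 * ‖ev (Λ n) c‖ ^ 2 * (‖(zeroPoly ζ m).eval (Λ n)‖ ^ 2 * ρ n) := by ring
        _ ≤ V ^ 2 * ‖ev (Λ n) c‖ ^ 2 * (κ⁻¹ * (1 - ‖Λ n‖ ^ 2)) := by
            have := (hρ0 n).le
            gcongr
        _ = V ^ 2 * κ⁻¹ * (‖ev (Λ n) c‖ ^ 2 * (1 - ‖Λ n‖ ^ 2)) := by ring)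
      ((hemb c).mul_left (V ^ 2 * κ⁻¹)))
  obtain ⟨x, hx⟩ := memHb_iff.1 hf
  obtain ⟨e, he⟩ := exists_ev_eval_mul (polyOf x.2) d₀
  refine ⟨x.1 - e, fun n => ?_⟩
  have h3 : (√(ρ n) : ℂ) ≠ 0 := by exact_mod_cast (Real.sqrt_pos.2 (hρ0 n)).ne'
  have h1 := mul_right_cancel₀ h3 (hfv n)
  rw [hx _ (hΛ n), evHb_apply] at h1
  refine mul_left_cancel₀ (norm_pos_iff.1 (hA n)) ?_
  rw [map_sub, he _ (hΛ n)]
  linear_combination h1 - (polyOf x.2).eval (Λ n) * hd₀ n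

end

section

variable {l : ℕ} {ζ : Fin l → ℂ} {m : Fin l → ℕ}

/-- Multipliers are bounded, holomorphic, and belong to the space. -/
lemma exists_bound_of_multiplier (hζ : ∀ j, ‖ζ j‖ = 1) (hN : 0 < ∑ j, m j) {φ : ℂ → ℂ}
    (hφ : ∀ f : ℂ → ℂ, MemHb ζ m f → MemHb ζ m fun z => φ z * f z) :
    (∃ x : SqSeq × (Fin (∑ j, m j) → ℂ), ∀ z : ℂ, ‖z‖ < 1 →
      φ z = evHb (zeroPoly ζ m) (∑ j, m j) z x) ∧
    DifferentiableOn ℂ φ (ball (0 : ℂ) 1) ∧ ∃ C : ℝ, ∀ z : ℂ, ‖z‖ < 1 → ‖φ z‖ ≤ C := by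
  have hx : ∃ x : SqSeq × (Fin (∑ j, m j) → ℂ), ∀ z : ℂ, ‖z‖ < 1 →
      φ z = evHb (zeroPoly ζ m) (∑ j, m j) z x := by
    obtain ⟨u, hu⟩ := exists_polyOf_eq (N := ∑ j, m j) (p := 1) (by
      rw [Polynomial.degree_one]; exact_mod_cast hN)
    obtain ⟨x, hx⟩ := memHb_iff.1 (hφ (fun _ => 1) (memHb_iff.2 ⟨(0, u), fun z _ => by
      rw [evHb_apply, hu]; simp⟩))
    exact ⟨x, fun z hz => by rw [← hx z hz, mul_one]⟩
  refine ⟨hx, ?_, ?_⟩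
  · obtain ⟨x, hx⟩ := hx
    have h1 : DifferentiableOn ℂ (fun z => (zeroPoly ζ m).eval z * ev z x.1 + (polyOf x.2).eval z)
        (ball (0 : ℂ) 1) :=
      DifferentiableOn.add (DifferentiableOn.mul (by fun_prop) (differentiableOn_ev x.1))
        (by fun_prop)
    exact h1.congr fun z hz => by rw [hx z (mem_ball_zero_iff.1 hz), evHb_apply]
  · obtain ⟨C, hC, hsol⟩ := exists_norm_le_of_solvable
      (fun z : {z : ℂ // ‖z‖ < 1} => evHb (zeroPoly ζ m) (∑ j, m j) z)
      (fun z => φ z • evHb (zeroPoly ζ m) (∑ j, m j) z) (fun y => by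
        obtain ⟨x, hx⟩ := memHb_iff.1 (hφ _ (memHb_iff.2 ⟨y, fun z _ => rfl⟩))
        exact ⟨x, fun z => (hx z z.2).symm⟩)
    refine ⟨C, fun z hz => ?_⟩
    have h1 : ‖φ z • evHb (zeroPoly ζ m) (∑ j, m j) z‖ ≤
        ‖evHb (zeroPoly ζ m) (∑ j, m j) z‖ * C := by
      refine ContinuousLinearMap.opNorm_le_bound _ (by positivity) fun y => ?_
      obtain ⟨x, hx, hxn⟩ := hsol y
      have h2 : evHb (zeroPoly ζ m) (∑ j, m j) z x =
        (φ z • evHb (zeroPoly ζ m) (∑ j, m j) z) y := hx ⟨z, hz⟩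
      rw [← h2, mul_assoc]
      exact (ContinuousLinearMap.le_opNorm _ _).trans (by gcongr)
    have h3 : 0 < ‖evHb (zeroPoly ζ m) (∑ j, m j) z‖ := by
      refine norm_pos_iff.2 fun h0 => ?_
      obtain ⟨c, -, hc⟩ := exists_ev_eval 1
      have h4 : evHb (zeroPoly ζ m) (∑ j, m j) z (c, 0) = 0 := by rw [h0]; rfl
      rw [evHb_apply, ← hc z hz] at h4
      simp only [Polynomial.eval_one, mul_one, polyOf, Pi.zero_apply, map_zero, zero_mul,
        Finset.sum_const_zero, Polynomial.eval_zero, add_zero] at h4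
      exact eval_zeroPoly_ne_zero hζ hz h4
    rw [norm_smul, mul_comm] at h1
    exact le_of_mul_le_mul_left h1 h3

/-- If `‖q‖² t` is summable along `B` but `t = (1 - ‖Λ‖²) / ‖w - Λ‖ ^ (2 * k)` is not, then the
polynomial `q` vanishes at `w`. -/
lemma eval_eq_zero_of_not_summable {Λ : ℕ → ℂ} (hΛ : ∀ n, ‖Λ n‖ < 1)
    (hs : Summable fun n => 1 - ‖Λ n‖ ^ 2) {w : ℂ} (k : ℕ) {B : Set ℕ}
    (hB : ¬ Summable (B.indicator fun n => (1 - ‖Λ n‖ ^ 2) / ‖w - Λ n‖ ^ (2 * k)))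
    {q : Polynomial ℂ} (hq : Summable (B.indicator fun n => ‖q.eval (Λ n)‖ ^ 2 *
      ((1 - ‖Λ n‖ ^ 2) / ‖w - Λ n‖ ^ (2 * k)))) : q.eval w = 0 := by
  by_contra h0
  have hL : ∀ n, 0 ≤ 1 - ‖Λ n‖ ^ 2 := fun n => (one_sub_norm_sq_pos (hΛ n)).le
  have hε : 0 < ‖q.eval w‖ / 2 := half_pos (norm_pos_iff.2 h0)
  have hev : ∀ᶠ z in 𝓝 w, ‖q.eval w‖ / 2 < ‖q.eval z‖ :=
    q.continuous.norm.continuousAt.eventually_const_lt (half_lt_self (norm_pos_iff.2 h0))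
  obtain ⟨δ, hδ, hδq⟩ := Metric.eventually_nhds_iff.1 hev
  refine hB (Summable.of_nonneg_of_le (fun n => Set.indicator_nonneg
    (fun n _ => div_nonneg (hL n) (by positivity)) n) (fun n => ?_)
    ((hq.mul_left ((‖q.eval w‖ / 2) ^ 2)⁻¹).add (hs.mul_left (δ ^ (2 * k))⁻¹)))
  by_cases hn : n ∈ B
  · rw [Set.indicator_of_mem hn, Set.indicator_of_mem hn]
    have ht : 0 ≤ (1 - ‖Λ n‖ ^ 2) / ‖w - Λ n‖ ^ (2 * k) := div_nonneg (hL n) (by positivity)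
    obtain h | h := lt_or_ge ‖w - Λ n‖ δ
    · have h1 : (‖q.eval w‖ / 2) ^ 2 ≤ ‖q.eval (Λ n)‖ ^ 2 :=
        pow_le_pow_left₀ hε.le (hδq (by rwa [dist_comm, dist_eq_norm])).le 2
      refine le_add_of_le_of_nonneg ?_ (mul_nonneg (by positivity) (hL n))
      rw [inv_mul_eq_div, le_div_iff₀ (by positivity), mul_comm]
      exact mul_le_mul_of_nonneg_right h1 ht
    · refine le_add_of_nonneg_of_le (by positivity) ?_
      rw [inv_mul_eq_div]
      exact div_le_div_of_nonneg_left (hL n) (by positivity) (pow_le_pow_left₀ hδ.le h _)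
  · rw [Set.indicator_of_notMem hn, Set.indicator_of_notMem hn, mul_zero, zero_add]
    exact mul_nonneg (by positivity) (hL n)

/-- Necessity of the geometric condition for multiplier interpolation. -/
lemma carlesonCond_of_multInterp (hζ : ∀ j, ‖ζ j‖ = 1) (hN : 0 < ∑ j, m j) {Λ : ℕ → ℂ}
    (hΛ : ∀ n, ‖Λ n‖ < 1) (h : MultInterp ζ m Λ) :
    CarlesonCond Λ ∧ ∀ j, Summable fun n => (1 - ‖Λ n‖ ^ 2) / ‖ζ j - Λ n‖ ^ (2 * m j) := by
  have hC : CarlesonCond Λ := by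
    refine carlesonCond_of_mul hΛ fun v hv c => ?_
    obtain ⟨φ, hφ, hφv⟩ := h v hv
    obtain ⟨-, hd, C, hC⟩ := exists_bound_of_multiplier hζ hN hφ
    obtain ⟨d, hd⟩ := exists_ev_mul hd hC c
    exact ⟨d, fun n => by rw [hd _ (hΛ n), hφv]⟩
  have hL : ∀ n, 0 ≤ 1 - ‖Λ n‖ ^ 2 := fun n => (one_sub_norm_sq_pos (hΛ n)).le
  obtain ⟨M, hM⟩ := exists_sum_norm_ev_sq_le hΛ hC
  have hemb : ∀ c : SqSeq, Summable fun n => ‖ev (Λ n) c‖ ^ 2 * (1 - ‖Λ n‖ ^ 2) := fun c =>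
    summable_of_sum_le (fun n => mul_nonneg (by positivity) (hL n)) (hM c)
  have hs : Summable fun n => 1 - ‖Λ n‖ ^ 2 := by
    obtain ⟨c, -, hc⟩ := exists_ev_eval 1
    refine (hemb c).congr fun n => ?_
    rw [← hc _ (hΛ n)]
    simp
  refine ⟨hC, fun j => ?_⟩
  by_contra hj
  obtain ⟨B, hB, hB'⟩ := exists_not_summable_indicator
    (fun n => div_nonneg (hL n) (by positivity)) hj
  obtain ⟨φ, hφ, hφv⟩ := h (B.indicator 1) ⟨1, fun n => by
    by_cases hn : n ∈ B <;> simp [hn]⟩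
  obtain ⟨⟨x, hx⟩, -⟩ := exists_bound_of_multiplier hζ hN hφ
  obtain ⟨C, hC0, hCA⟩ := exists_norm_eval_zeroPoly_le ζ m
  have hsum : Summable fun n => ‖(zeroPoly ζ m).eval (Λ n) * ev (Λ n) x.1‖ ^ 2 *
      ((1 - ‖Λ n‖ ^ 2) / ‖ζ j - Λ n‖ ^ (2 * m j)) := by
    refine Summable.of_nonneg_of_le
      (fun n => mul_nonneg (by positivity) (div_nonneg (hL n) (by positivity))) (fun n => ?_)
      ((hemb x.1).mul_left (C ^ 2))
    have h1 := norm_sub_pos hζ (hΛ n) j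
    rw [← mul_div_assoc, div_le_iff₀ (by positivity), norm_mul, mul_pow]
    have h2 : ‖(zeroPoly ζ m).eval (Λ n)‖ ^ 2 ≤ C ^ 2 * ‖ζ j - Λ n‖ ^ (2 * m j) := by
      rw [mul_comm 2, pow_mul, ← mul_pow]
      exact pow_le_pow_left₀ (norm_nonneg _) (hCA j _ (hΛ n).le) 2
    have h3 : 0 ≤ ‖ev (Λ n) x.1‖ ^ 2 * (1 - ‖Λ n‖ ^ 2) := mul_nonneg (by positivity) (hL n)
    calc _ = ‖(zeroPoly ζ m).eval (Λ n)‖ ^ 2 * (‖ev (Λ n) x.1‖ ^ 2 * (1 - ‖Λ n‖ ^ 2)) := by ring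
      _ ≤ _ := mul_le_mul_of_nonneg_right h2 h3
      _ = _ := by ring
  have hv : ∀ n, (zeroPoly ζ m).eval (Λ n) * ev (Λ n) x.1 =
      B.indicator 1 n - (polyOf x.2).eval (Λ n) := fun n => by
    rw [← hφv, hx _ (hΛ n), evHb_apply, add_sub_cancel_right]
  have h1 : (1 - polyOf x.2).eval (ζ j) = 0 :=
    eval_eq_zero_of_not_summable hΛ hs (m j) hB ((hsum.indicator B).congr fun n => by
      by_cases hn : n ∈ B <;> simp [hn, hv])
  have h2 : (polyOf x.2).eval (ζ j) = 0 :=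
    eval_eq_zero_of_not_summable hΛ hs (m j) hB' ((hsum.indicator Bᶜ).congr fun n => by
      by_cases hn : n ∈ B <;> simp [hn, hv])
  rw [Polynomial.eval_sub, h2, Polynomial.eval_one, sub_zero] at h1
  exact one_ne_zero h1

end

/-- **Theorem (main theorem).** Let `b` be a rational function in the closed unit ball of `H^∞`
with `‖b‖_∞ = 1`, non-extreme, with Pythagorean mate `a`, and let `ζ 1, …, ζ l ∈ 𝕋` be the
zeros of `a` on the circle with multiplicities `m 1, …, m l` (so that, `a` being outer and
rational, `a = ∏ (z-ζ j)^{m j} · P/Q` with `P, Q` polynomials zero-free on the closed disk).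
For a sequence `Λ` in `𝔻`, the following are equivalent:
(i) `Λ` is multiplier interpolating for `H(b)`;
(ii) `Λ` is universal interpolating for `H(b)`;
(iii) `Λ` satisfies the Carleson condition and
      `∑_n (1-|Λ n|²)/|ζ j - Λ n|^{2 m j} < ∞` for every `j`. -/
theorem statement0
    (b a : ℂ → ℂ) (l : ℕ) (ζ : Fin l → ℂ) (m : Fin l → ℕ)
    -- `ζ j` are distinct points of the unit circle, with multiplicities `m j ≥ 1`
    (hζ : ∀ j, ‖ζ j‖ = 1) (hζinj : Function.Injective ζ) (hm : ∀ j, 1 ≤ m j)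
    -- `b` is rational, with no poles on the closed disk
    (hb_rat : ∃ P Q : Polynomial ℂ, (∀ z : ℂ, ‖z‖ ≤ 1 → Q.eval z ≠ 0) ∧
      ∀ z : ℂ, ‖z‖ ≤ 1 → b z = P.eval z / Q.eval z)
    -- `b` is in the closed unit ball of `H^∞` with `‖b‖_∞ = 1`
    (hb_le : ∀ z : ℂ, ‖z‖ ≤ 1 → ‖b z‖ ≤ 1)
    (hb_norm : ∃ z : ℂ, ‖z‖ = 1 ∧ ‖b z‖ = 1)
    -- `b` is non-extreme (equivalently, not inner / not a finite Blaschke product)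
    (hb_nonextreme : ∃ z : ℂ, ‖z‖ = 1 ∧ ‖b z‖ < 1)
    -- `a` is the Pythagorean mate: outer (zero-free on `𝔻`) and rational, with boundary zeros
    -- exactly the `ζ j` with multiplicities `m j`, `a(0) > 0`, and `|a|² + |b|² = 1` on `𝕋`
    (ha_form : ∃ P Q : Polynomial ℂ, (∀ z : ℂ, ‖z‖ ≤ 1 → P.eval z ≠ 0 ∧ Q.eval z ≠ 0) ∧
      ∀ z : ℂ, ‖z‖ ≤ 1 → a z = (∏ j, (z - ζ j) ^ m j) * P.eval z / Q.eval z)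
    (ha_le : ∀ z : ℂ, ‖z‖ ≤ 1 → ‖a z‖ ≤ 1)
    (ha0 : 0 < (a 0).re ∧ (a 0).im = 0)
    (hab : ∀ z : ℂ, ‖z‖ = 1 → ‖a z‖ ^ 2 + ‖b z‖ ^ 2 = 1)
    -- `Λ` is a sequence in the unit disk
    (Λ : ℕ → ℂ) (hΛ : ∀ n, ‖Λ n‖ < 1) :
    (MultInterp ζ m Λ ↔ UnivInterp ζ m b Λ) ∧
    (UnivInterp ζ m b Λ ↔
      (CarlesonCond Λ ∧
        ∀ j, Summable fun n => (1 - ‖Λ n‖ ^ 2) / ‖ζ j - Λ n‖ ^ (2 * m j))) := by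
  obtain ⟨j₀⟩ : Nonempty (Fin l) := by
    obtain ⟨z, hz, hbz⟩ := hb_norm
    obtain ⟨P, Q, hPQ, ha⟩ := ha_form
    have h1 := hab z hz
    have h2 : a z = 0 := by
      rw [hbz, one_pow, add_eq_right] at h1
      exact norm_eq_zero.1 (pow_eq_zero_iff two_ne_zero |>.1 h1)
    rw [ha z hz.le, div_eq_zero_iff, or_iff_left (hPQ z hz.le).2, mul_eq_zero,
      or_iff_left (hPQ z hz.le).1, ← eval_zeroPoly, eval_zeroPoly_eq_zero_iff hm] at h2
    exact h2.nonempty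
  have : Nonempty (Fin l) := ⟨j₀⟩
  have hN : 0 < ∑ j, m j :=
    Finset.sum_pos (fun j _ => hm j) Finset.univ_nonempty
  obtain ⟨κ, K, hκ, hK, hb⟩ := exists_one_sub_norm_sq_bounds hζ hb_rat hb_le ha_form hab
  have hiff := summable_div_norm_eval_zeroPoly_iff (m := m) hζ hζinj hΛ
  have hM : MultInterp ζ m Λ ↔ CarlesonCond Λ ∧
      ∀ j, Summable fun n => (1 - ‖Λ n‖ ^ 2) / ‖ζ j - Λ n‖ ^ (2 * m j) :=
    ⟨carlesonCond_of_multInterp hζ hN hΛ,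
      fun h => multInterp_of_carlesonCond hζ hΛ h.1 (hiff.2 h.2)⟩
  have hU : UnivInterp ζ m b Λ ↔ CarlesonCond Λ ∧
      ∀ j, Summable fun n => (1 - ‖Λ n‖ ^ 2) / ‖ζ j - Λ n‖ ^ (2 * m j) :=
    ⟨fun h => (carlesonCond_of_univInterp hζ hm hN hκ hK hb hΛ h).imp_right hiff.1,
      fun h => univInterp_of_carlesonCond hζ hκ hb hΛ h.1 (hiff.2 h.2)⟩
  exact ⟨hM.trans hU.symm, hU⟩
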